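/- arXiv:2510.11441 — 3 statements merged into one kernel-verified Lean document; each statement's English description precedes it below -/
import Mathlib

section
/- The hyperbolic set H = {(a,b) ∈ ℝ/ℤ × [0,1) : f_{a,b} has an attracting periodic orbit} is an open subset of ℝ/ℤ × [0,1]. -/
open Set Filter Topology

noncomputable section

/-- Representative of a point of the circle in `[0,1)`. -/
noncomputable def rep (z : UnitAddCircle) : ℝ := (AddCircle.equivIco 1 0 z).val

/-- The straight sine map on `[0,1)`. -/
noncomputable def Sfun (t : ℝ) : ℝ := if t ≤ 1/2 then 4*t - 1 else -4*t + 3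

/-- The piecewise linear perturbation of the doubling map. -/
noncomputable def plpdm (a : UnitAddCircle) (b : ℝ) (z : UnitAddCircle) : UnitAddCircle :=
  ((2 * rep z + (b/2) * Sfun (rep z) : ℝ) : UnitAddCircle) + a

/-- The doubling map. -/
def Dbl (z : UnitAddCircle) : UnitAddCircle := z + z

/-- `x` is an attracting periodic point of `f` of exact period `n`. -/
def IsAttractingPeriodicPt (f : UnitAddCircle → UnitAddCircle) (n : ℕ)
    (x : UnitAddCircle) : Prop :=
  0 < n ∧ f^[n] x = x ∧ (∀ m, 0 < m → m < n → f^[m] x ≠ x) ∧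
  ∃ U : Set UnitAddCircle, IsOpen U ∧ IsConnected U ∧ x ∈ U ∧ f^[n] '' U ⊆ U ∧
    ∀ y ∈ U, Tendsto (fun k => f^[n*k] y) atTop (nhds x)

/-- Forward orbit of `x` under `f`. -/
def orbitSet (f : UnitAddCircle → UnitAddCircle) (x : UnitAddCircle) : Set UnitAddCircle :=
  {y | ∃ i, f^[i] x = y}

/-- Basin of attraction of the set `O`. -/
def basin (f : UnitAddCircle → UnitAddCircle) (O : Set UnitAddCircle) : Set UnitAddCircle :=
  {y | Tendsto (fun k => Metric.infDist (f^[k] y) O) atTop (nhds 0)}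

/-- Immediate basin of attraction of the orbit `O`. -/
def immBasin (f : UnitAddCircle → UnitAddCircle) (O : Set UnitAddCircle) :
    Set UnitAddCircle :=
  ⋃ z ∈ O, connectedComponentIn (basin f O) z

/-- The hyperbolic set `H`. -/
def hypSet : Set (UnitAddCircle × ℝ) :=
  {q | q.2 ∈ Set.Ico (0:ℝ) 1 ∧ ∃ n x, IsAttractingPeriodicPt (plpdm q.1 q.2) n x}

/-- The lift `F_{a,b}` of `f_{a,b}`, normalized so that `F_{a,b}(0) ∈ [0,1)`. -/
noncomputable def liftF (a : UnitAddCircle) (b : ℝ) (x : ℝ) : ℝ :=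
  (2 * Int.fract x + rep a + (b/2) * Sfun (Int.fract x)
    + (if rep a - b/2 < 0 then 1 else 0)) + 2 * (⌊x⌋ : ℝ)

/-- `Φ_{a,b}`, the limit of `F_{a,b}^n(x)/2^n`. -/
noncomputable def Phi (a : UnitAddCircle) (b : ℝ) (x : ℝ) : ℝ :=
  limUnder atTop (fun n : ℕ => (liftF a b)^[n] x / 2 ^ n)

/-- The semiconjugacy `φ_{a,b}` induced by `Φ_{a,b}`. -/
noncomputable def phiMap (a : UnitAddCircle) (b : ℝ) (z : UnitAddCircle) : UnitAddCircle :=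
  ((Phi a b (rep z) : ℝ) : UnitAddCircle)

/-- The arc `I₊ = [0,1/2]` of the circle. -/
def Iplus : Set UnitAddCircle := (fun t : ℝ => (t : UnitAddCircle)) '' Set.Icc 0 (1/2)

/-- The arc `I₋ = [1/2,1]` of the circle. -/
def Iminus : Set UnitAddCircle := (fun t : ℝ => (t : UnitAddCircle)) '' Set.Icc (1/2) 1

/-- The orbit of `x` (of period `p`) avoids `0`, `1/2` and has slope itinerary `σ`,
where `σ j = true` encodes the symbol `−` and `σ j = false` encodes `+`. -/
def HasItinerary (f : UnitAddCircle → UnitAddCircle) (p : ℕ) (x : UnitAddCircle)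
    (σ : Fin p → Bool) : Prop :=
  (∀ j : Fin p, f^[(j : ℕ)] x ≠ (0 : UnitAddCircle) ∧
      f^[(j : ℕ)] x ≠ (((1:ℝ)/2 : ℝ) : UnitAddCircle)) ∧
  ∀ j : Fin p, (σ j = true → f^[(j : ℕ)] x ∈ Iminus) ∧ (σ j = false → f^[(j : ℕ)] x ∈ Iplus)

/-- The set `P_σ` of parameters whose attracting orbit has slope itinerary `σ`. -/
def paramSet (p : ℕ) (σ : Fin p → Bool) : Set (UnitAddCircle × ℝ) :=
  {q | q.2 ∈ Set.Ico (0:ℝ) 1 ∧ ∃ x, IsAttractingPeriodicPt (plpdm q.1 q.2) p x ∧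
       HasItinerary (plpdm q.1 q.2) p x σ}

/-- `S` is a tongue: its closure meets `ℝ/ℤ × {1}` in a nondegenerate interval. -/
def IsTongue (S : Set (UnitAddCircle × ℝ)) : Prop :=
  ∃ u v : ℝ, u < v ∧ ∀ t ∈ Set.Icc u v, (((t : ℝ) : UnitAddCircle), (1:ℝ)) ∈ closure S

end


namespace PlpdmOpen

/-- The lift to `ℝ` of `plpdm c b`, with the tent map written through the circle norm. -/
noncomputable def lift (c b t : ℝ) : ℝ := 2 * t + c + (b / 2) * (4 * ‖(t : UnitAddCircle)‖ - 1)

lemma norm_coe_eq_min (t : ℝ) : ‖(t : UnitAddCircle)‖ = min (Int.fract t) (1 - Int.fract t) := by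
  rw [UnitAddCircle.norm_eq, abs_sub_round_eq_min]

lemma Sfun_fract (t : ℝ) : Sfun (Int.fract t) = 4 * ‖(t : UnitAddCircle)‖ - 1 := by
  rw [norm_coe_eq_min, Sfun]
  split_ifs with h
  · rw [min_eq_left (by linarith)]
  · rw [min_eq_right (by linarith)]; ring

lemma rep_coe (t : ℝ) : rep (t : UnitAddCircle) = Int.fract t := by
  simp [rep, AddCircle.coe_equivIco_mk_apply]

lemma plpdm_coe (c b t : ℝ) :
    plpdm (c : UnitAddCircle) b (t : UnitAddCircle) = ((lift c b t : ℝ) : UnitAddCircle) := by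
  rw [plpdm, rep_coe, Sfun_fract, ← AddCircle.coe_add, ← sub_eq_zero, ← AddCircle.coe_sub,
    AddCircle.coe_eq_zero_iff]
  refine ⟨-(2 * ⌊t⌋), ?_⟩
  have := Int.fract_add_floor t
  simp only [lift, zsmul_eq_mul]
  push_cast
  linarith

lemma plpdm_iterate_coe (c b t : ℝ) (k : ℕ) :
    (plpdm (c : UnitAddCircle) b)^[k] (t : UnitAddCircle)
      = (((lift c b)^[k] t : ℝ) : UnitAddCircle) :=
  ((Function.Semiconj.iterate_right (f := fun t : ℝ => (t : UnitAddCircle))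
    (fun t => (plpdm_coe c b t).symm) k) t).symm

lemma continuous_norm_coe : Continuous fun t : ℝ => ‖(t : UnitAddCircle)‖ :=
  (AddCircle.continuous_mk' 1).norm

lemma continuous_lift_iterate_uncurry (k : ℕ) :
    Continuous fun q : (ℝ × ℝ) × ℝ => (lift q.1.1 q.1.2)^[k] q.2 := by
  induction k with
  | zero => simpa using continuous_snd
  | succ k ih =>
    simp only [Function.iterate_succ_apply', lift]
    have := continuous_norm_coe.comp ih
    simp only [Function.comp_def] at this
    fun_prop

lemma continuous_lift_iterate (c b : ℝ) (k : ℕ) : Continuous ((lift c b)^[k]) :=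
  (continuous_lift_iterate_uncurry k).comp (f := fun t : ℝ => ((c, b), t)) (by fun_prop)

lemma continuous_param_lift_iterate (t : ℝ) (k : ℕ) :
    Continuous fun q : ℝ × ℝ => (lift q.1 q.2)^[k] t :=
  (continuous_lift_iterate_uncurry k).comp (f := fun q : ℝ × ℝ => (q, t)) (by fun_prop)

lemma lift_strictMono (c : ℝ) {b : ℝ} (hb : |b| < 1) : StrictMono (lift c b) := by
  intro y z hyz
  have h : |‖(z : UnitAddCircle)‖ - ‖(y : UnitAddCircle)‖| ≤ z - y := by
    refine (abs_norm_sub_norm_le _ _).trans ?_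
    rw [← AddCircle.coe_sub]
    refine (QuotientAddGroup.norm_mk_le_norm).trans ?_
    rw [Real.norm_eq_abs, abs_of_pos (by linarith)]
  have h2 : |b * (‖(z : UnitAddCircle)‖ - ‖(y : UnitAddCircle)‖)| < z - y := by
    rw [abs_mul]
    calc _ ≤ |b| * (z - y) := by gcongr
      _ < 1 * (z - y) := mul_lt_mul_of_pos_right hb (sub_pos.2 hyz)
      _ = _ := one_mul _
  have := (abs_lt.1 h2).1
  simp only [lift]
  linarith

lemma lift_iterate_strictMono (c : ℝ) {b : ℝ} (hb : |b| < 1) (k : ℕ) :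
    StrictMono ((lift c b)^[k]) := (lift_strictMono c hb).iterate k

lemma lift_add_int (c b t : ℝ) (m : ℤ) : lift c b (t + m) = lift c b t + 2 * m := by
  have : ((t + m : ℝ) : UnitAddCircle) = t := by
    rw [← sub_eq_zero, ← AddCircle.coe_sub, AddCircle.coe_eq_zero_iff]
    exact ⟨m, by simp⟩
  simp only [lift, this]
  ring

lemma lift_iterate_add_int (c b t : ℝ) (m : ℤ) (k : ℕ) :
    (lift c b)^[k] (t + m) = (lift c b)^[k] t + 2 ^ k * m := by
  induction k with
  | zero => simp
  | succ k ih =>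
    have := lift_add_int c b ((lift c b)^[k] t) (2 ^ k * m)
    push_cast at this
    rw [Function.iterate_succ_apply', Function.iterate_succ_apply', ih, this]
    ring

lemma lift_neg (c b t : ℝ) : lift c b (-t) = -lift (-c) (-b) t := by
  simp only [lift, AddCircle.coe_neg, norm_neg]
  ring

lemma lift_iterate_neg (c b t : ℝ) (k : ℕ) :
    (lift c b)^[k] (-t) = -(lift (-c) (-b))^[k] t := by
  induction k with
  | zero => simp
  | succ k ih => rw [Function.iterate_succ_apply', Function.iterate_succ_apply', ih, lift_neg]

lemma lift_iterate_mono_param {c c' b : ℝ} (hb : |b| < 1) (hc : c ≤ c') (k : ℕ) (t : ℝ) :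
    (lift c b)^[k] t ≤ (lift c' b)^[k] t :=
  (lift_strictMono c hb).monotone.iterate_le_of_le (fun s => by simp only [lift]; linarith) k t

lemma lift_iterate_strictMono_param {c c' b : ℝ} (hb : |b| < 1) (hc : c < c') {k : ℕ}
    (hk : 0 < k) (t : ℝ) : (lift c b)^[k] t < (lift c' b)^[k] t := by
  obtain ⟨k, rfl⟩ := Nat.exists_eq_succ_of_ne_zero hk.ne'
  rw [Function.iterate_succ_apply', Function.iterate_succ_apply']
  calc lift c b ((lift c b)^[k] t) ≤ lift c b ((lift c' b)^[k] t) :=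
        (lift_strictMono c hb).monotone (lift_iterate_mono_param hb hc.le k t)
    _ < _ := by simp only [lift]; linarith

lemma fract_eq_add {t y : ℝ} (h0 : 0 ≤ Int.fract t + (y - t)) (h1 : Int.fract t + (y - t) < 1) :
    Int.fract y = Int.fract t + (y - t) := by
  rw [Int.fract_eq_iff]
  refine ⟨h0, h1, ⌊t⌋, ?_⟩
  have := Int.fract_add_floor t
  linarith

lemma norm_coe_right_affine (t : ℝ) : ∃ σ : ℝ, (σ = 1 ∨ σ = -1) ∧ ∃ δ > 0, ∀ y ∈ Icc t (t + δ),
    ‖(y : UnitAddCircle)‖ = ‖(t : UnitAddCircle)‖ + σ * (y - t) := by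
  have h0 := Int.fract_nonneg t
  have h1 := Int.fract_lt_one t
  rcases lt_or_ge (Int.fract t) (1 / 2) with h | h
  · refine ⟨1, Or.inl rfl, 1 / 2 - Int.fract t, by linarith, fun y hy => ?_⟩
    rw [mem_Icc] at hy
    rw [norm_coe_eq_min, norm_coe_eq_min, fract_eq_add (t := t) (y := y) (by linarith)
      (by linarith), min_eq_left (by linarith), min_eq_left (by linarith)]
    ring
  · refine ⟨-1, Or.inr rfl, (1 - Int.fract t) / 2, by linarith, fun y hy => ?_⟩
    rw [mem_Icc] at hy
    rw [norm_coe_eq_min, norm_coe_eq_min, fract_eq_add (t := t) (y := y) (by linarith)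
      (by linarith), min_eq_right (by linarith), min_eq_right (by linarith)]
    ring

lemma lift_iterate_affine_right {b : ℝ} (hb : |b| < 1) (c₀ x : ℝ) (n : ℕ) :
    ∃ δ > 0, ∃ i ≤ n, ∀ c ≥ c₀, ∀ r, (∀ k < n, (lift c b)^[k] r ≤ (lift c₀ b)^[k] x + δ) →
      ∀ y ∈ Icc x r, (lift c b)^[n] y
        = (lift c b)^[n] x + (2 + 2 * b) ^ i * (2 - 2 * b) ^ (n - i) * (y - x) := by
  induction n with
  | zero => exact ⟨1, one_pos, 0, le_rfl, fun c _ r _ y _ => by simp⟩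
  | succ n ih =>
    obtain ⟨δ, hδ, i, hi, H⟩ := ih
    obtain ⟨σ, hσ, δ', hδ', H'⟩ := norm_coe_right_affine ((lift c₀ b)^[n] x)
    have key : ∀ c ≥ c₀, ∀ r, (∀ k < n + 1, (lift c b)^[k] r ≤ (lift c₀ b)^[k] x + min δ δ') →
        ∀ y ∈ Icc x r, (lift c b)^[n + 1] y = (lift c b)^[n + 1] x
          + (2 + 2 * b * σ) * ((2 + 2 * b) ^ i * (2 - 2 * b) ^ (n - i) * (y - x)) := by
      intro c hc r hr y hy
      have e := H c hc r (fun k hk => (hr k (by lia)).trans (by gcongr; exact min_le_left _ _)) y hy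
      have mem : ∀ z ∈ Icc x r,
          (lift c b)^[n] z ∈ Icc ((lift c₀ b)^[n] x) ((lift c₀ b)^[n] x + δ') := fun z hz =>
        ⟨(lift_iterate_mono_param hb hc n x).trans
            ((lift_iterate_strictMono c hb n).monotone hz.1),
          ((lift_iterate_strictMono c hb n).monotone hz.2).trans
            ((hr n (by lia)).trans (by gcongr; exact min_le_right _ _))⟩
      have e1 := H' _ (mem y hy)
      have e2 := H' _ (mem x ⟨le_rfl, hy.1.trans hy.2⟩)
      rw [Function.iterate_succ_apply', Function.iterate_succ_apply']
      simp only [lift] at e e1 e2 ⊢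
      rw [e1, e2]
      linear_combination (2 + 2 * b * σ) * e
    rcases hσ with rfl | rfl
    · refine ⟨min δ δ', lt_min hδ hδ', i + 1, by lia, fun c hc r hr y hy => ?_⟩
      rw [key c hc r hr y hy, Nat.add_sub_add_right]
      ring
    · refine ⟨min δ δ', lt_min hδ hδ', i, by lia, fun c hc r hr y hy => ?_⟩
      rw [key c hc r hr y hy, Nat.sub_add_comm hi]
      ring

lemma lift_iterate_affine_left {b : ℝ} (hb : |b| < 1) (c₀ x : ℝ) (n : ℕ) :
    ∃ δ > 0, ∃ s : ℝ, ∀ c ≤ c₀, ∀ l, (∀ k < n, (lift c₀ b)^[k] x - δ ≤ (lift c b)^[k] l) →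
      ∀ y ∈ Icc l x, (lift c b)^[n] y = (lift c b)^[n] x + s * (y - x) := by
  obtain ⟨δ, hδ, i, -, H⟩ :=
    lift_iterate_affine_right (b := -b) (by rwa [abs_neg]) (-c₀) (-x) n
  refine ⟨δ, hδ, (2 + 2 * -b) ^ i * (2 - 2 * -b) ^ (n - i), fun c hc l hl y hy => ?_⟩
  have := H (-c) (by simpa using hc) (-l) (fun k hk => ?_) (-y) ⟨neg_le_neg hy.2, neg_le_neg hy.1⟩
  · rw [lift_iterate_neg, lift_iterate_neg, neg_neg, neg_neg] at this
    rw [← neg_inj, this]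
    ring
  · have := hl k hk
    simp only [lift_iterate_neg, neg_neg]
    linarith

lemma eventually_lift_iterate_close (c b x : ℝ) (n : ℕ) {δ : ℝ} (hδ : 0 < δ) :
    ∀ᶠ r in 𝓝 x, ∀ k < n, |(lift c b)^[k] r - (lift c b)^[k] x| < δ := by
  have : ∀ᶠ r in 𝓝 x, ∀ k ∈ Finset.range n, |(lift c b)^[k] r - (lift c b)^[k] x| < δ := by
    rw [Filter.eventually_all_finset]
    intro k _
    have := Metric.tendsto_nhds.1 ((continuous_lift_iterate c b k).tendsto x) δ hδ
    simpa only [Real.dist_eq] using this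
  simpa only [Finset.mem_range] using this

lemma lift_iterate_affine_nhds_right {b : ℝ} (hb : |b| < 1) (c x : ℝ) (n : ℕ) :
    ∃ r > x, ∃ i ≤ n, ∀ y ∈ Icc x r, (lift c b)^[n] y
        = (lift c b)^[n] x + (2 + 2 * b) ^ i * (2 - 2 * b) ^ (n - i) * (y - x) := by
  obtain ⟨δ, hδ, i, hi, H⟩ := lift_iterate_affine_right hb c x n
  have h1 : ∀ᶠ r in 𝓝[>] x, x < r := eventually_mem_nhdsWithin
  obtain ⟨r, hr, hxr⟩ := (h1.and
    ((eventually_lift_iterate_close c b x n hδ).filter_mono nhdsWithin_le_nhds)).exists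
  exact ⟨r, hr, i, hi, H c le_rfl r fun k hk => by linarith [(abs_lt.1 (hxr k hk)).2]⟩

lemma lift_iterate_affine_nhds_left {b : ℝ} (hb : |b| < 1) (c x : ℝ) (n : ℕ) :
    ∃ l < x, ∃ s : ℝ, ∀ y ∈ Icc l x, (lift c b)^[n] y = (lift c b)^[n] x + s * (y - x) := by
  obtain ⟨δ, hδ, s, H⟩ := lift_iterate_affine_left hb c x n
  have h1 : ∀ᶠ r in 𝓝[<] x, r < x := eventually_mem_nhdsWithin
  obtain ⟨l, hl, hxl⟩ := (h1.and
    ((eventually_lift_iterate_close c b x n hδ).filter_mono nhdsWithin_le_nhds)).exists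
  exact ⟨l, hl, s, H c le_rfl l fun k hk => by linarith [(abs_lt.1 (hxl k hk)).1]⟩

/-- Iterates of an integer translate of a lift of `f^n` are integer translates of lifts. -/
lemma iterate_sub_int (c b : ℝ) (n : ℕ) (m : ℤ) (k : ℕ) :
    ∃ M : ℤ, ∀ y, (fun t => (lift c b)^[n] t - m)^[k] y = (lift c b)^[n * k] y - M := by
  induction k with
  | zero => exact ⟨0, by simp⟩
  | succ k ih =>
    obtain ⟨M, hM⟩ := ih
    refine ⟨2 ^ n * M + m, fun y => ?_⟩
    have := lift_iterate_add_int c b ((lift c b)^[n * k] y) (-M) n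
    rw [Function.iterate_succ_apply', hM, Nat.mul_succ, Nat.add_comm (n * k),
      Function.iterate_add_apply]
    push_cast at this ⊢
    rw [sub_eq_add_neg _ (M : ℝ), this]
    ring

lemma coe_sub_int (t : ℝ) (m : ℤ) : ((t - m : ℝ) : UnitAddCircle) = t := by
  rw [← sub_eq_zero, ← AddCircle.coe_sub, AddCircle.coe_eq_zero_iff]
  exact ⟨-m, by simp⟩

lemma coe_eq_coe_iff {s t : ℝ} : (s : UnitAddCircle) = t ↔ ∃ m : ℤ, s = t + m := by
  rw [← sub_eq_zero, ← AddCircle.coe_sub, AddCircle.coe_eq_zero_iff]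
  simp only [zsmul_eq_mul, mul_one]
  exact exists_congr fun m => ⟨fun h => by linarith, fun h => by linarith⟩

lemma plpdm_iterate_mul_coe (c b t : ℝ) (n k : ℕ) (m : ℤ) :
    (plpdm (c : UnitAddCircle) b)^[n * k] (t : UnitAddCircle)
      = (((fun t => (lift c b)^[n] t - m)^[k] t : ℝ) : UnitAddCircle) := by
  obtain ⟨M, hM⟩ := iterate_sub_int c b n m k
  rw [hM, coe_sub_int, plpdm_iterate_coe]

lemma tendsto_iterate_of_lt_right {h : ℝ → ℝ} (hc : Continuous h) (hm : Monotone h) {p r : ℝ}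
    (hp : h p = p) (hr : ∀ y ∈ Ioo p r, h y < y) {y : ℝ} (hy : y ∈ Ioo p r) :
    Tendsto (fun k => h^[k] y) atTop (𝓝 p) := by
  have hanti : Antitone fun k => h^[k] y := hm.antitone_iterate_of_map_le (hr y hy).le
  have hlow : ∀ k, p ≤ h^[k] y := fun k => by
    simpa [Function.iterate_fixed hp] using hm.iterate k hy.1.le
  have ht := tendsto_atTop_ciInf hanti ⟨p, by rintro _ ⟨k, rfl⟩; exact hlow k⟩
  have hfix := isFixedPt_of_tendsto_iterate ht hc.continuousAt
  have h1 : p ≤ ⨅ k, h^[k] y := le_ciInf hlow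
  have h2 : ⨅ k, h^[k] y ≤ y := ciInf_le (f := fun k => h^[k] y)
    ⟨p, by rintro _ ⟨k, rfl⟩; exact hlow k⟩ 0
  rcases h1.eq_or_lt with e | e
  · rwa [← e] at ht
  · exact absurd hfix (hr _ ⟨e, h2.trans_lt hy.2⟩).ne

lemma tendsto_iterate_of_lt_left {h : ℝ → ℝ} (hc : Continuous h) (hm : Monotone h) {l p : ℝ}
    (hp : h p = p) (hl : ∀ y ∈ Ioo l p, y < h y) {y : ℝ} (hy : y ∈ Ioo l p) :
    Tendsto (fun k => h^[k] y) atTop (𝓝 p) := by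
  have hsemi : ∀ k t, (fun s => -h (-s))^[k] t = -h^[k] (-t) := fun k t => by
    induction k with
    | zero => simp
    | succ k ih => rw [Function.iterate_succ_apply', Function.iterate_succ_apply', ih, neg_neg]
  have := tendsto_iterate_of_lt_right (h := fun s => -h (-s)) (p := -p) (r := -l) (y := -y)
    (by fun_prop) (fun s t hst => neg_le_neg (hm (neg_le_neg hst))) (by simp [hp])
    (fun s hs => by linarith [hl (-s) ⟨by linarith [hs.2], by linarith [hs.1]⟩])
    ⟨neg_lt_neg hy.2, neg_lt_neg hy.1⟩
  simpa [hsemi] using this.neg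

/-- A fixed point of a lift of `f^n` attracting from both sides projects to an attracting
periodic point. -/
lemma exists_attracting_of_lift {b : ℝ} (hb : |b| < 1) {c p l r : ℝ} {n : ℕ} {m : ℤ}
    (hn : 0 < n) (hlp : l < p) (hpr : p < r) (hp : (lift c b)^[n] p - m = p)
    (hl : ∀ y ∈ Ioo l p, y < (lift c b)^[n] y - m) (hr : ∀ y ∈ Ioo p r, (lift c b)^[n] y - m < y) :
    ∃ n x, IsAttractingPeriodicPt (plpdm (c : UnitAddCircle) b) n x := by
  set f := plpdm (c : UnitAddCircle) b with hf
  have hper : Function.IsPeriodicPt f n (p : UnitAddCircle) := by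
    rw [Function.IsPeriodicPt, Function.IsFixedPt, hf, plpdm_iterate_coe]
    conv_rhs => rw [← hp, coe_sub_int]
  set n' := Function.minimalPeriod f (p : UnitAddCircle) with hn'
  have hn'0 : 0 < n' := hper.minimalPeriod_pos hn
  have hfix : f^[n'] (p : UnitAddCircle) = p := Function.iterate_minimalPeriod
  obtain ⟨m', hm'⟩ : ∃ m' : ℤ, (lift c b)^[n'] p = p + m' := by
    rwa [hf, plpdm_iterate_coe, coe_eq_coe_iff] at hfix
  obtain ⟨q, hq⟩ := hper.minimalPeriod_dvd
  set h : ℝ → ℝ := fun t => (lift c b)^[n'] t - m' with hh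
  have hhc : Continuous h := (continuous_lift_iterate c b n').sub continuous_const
  have hhm : Monotone h := fun s t hst =>
    sub_le_sub_right ((lift_iterate_strictMono c hb n').monotone hst) _
  have hhp : h p = p := by simp [hh, hm']
  have hiter : ∀ y, h^[q] y = (lift c b)^[n] y - m := by
    obtain ⟨M, hM⟩ := iterate_sub_int c b n' m' q
    rw [← hn', ← hq] at *
    have h1 : h^[q] p = _ := hM p
    rw [Function.iterate_fixed hhp] at h1
    intro y
    rw [hM y]
    linarith
  have hhl : ∀ y ∈ Ioo l p, y < h y := fun y hy => by
    by_contra! hle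
    have := hhm.antitone_iterate_of_map_le hle (Nat.zero_le q)
    simp only [hiter, Function.iterate_zero, id] at this
    exact absurd (hl y hy) this.not_gt
  have hhr : ∀ y ∈ Ioo p r, h y < y := fun y hy => by
    by_contra! hle
    have := hhm.monotone_iterate_of_le_map hle (Nat.zero_le q)
    simp only [hiter, Function.iterate_zero, id] at this
    exact absurd (hr y hy) this.not_gt
  refine ⟨n', p, hn'0, hfix, fun k hk hkn => ?_, (fun t : ℝ => (t : UnitAddCircle)) '' Ioo l r,
    QuotientAddGroup.isOpenMap_coe _ isOpen_Ioo,
    (isConnected_Ioo (hlp.trans hpr)).image _ (AddCircle.continuous_mk' 1).continuousOn,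
    ⟨p, ⟨hlp, hpr⟩, rfl⟩, ?_, ?_⟩
  · exact Function.not_isPeriodicPt_of_pos_of_lt_minimalPeriod hk.ne' hkn
  · rintro _ ⟨_, ⟨y, hy, rfl⟩, rfl⟩
    refine ⟨h y, ?_, ?_⟩
    · rcases lt_trichotomy y p with hyp | rfl | hyp
      · exact ⟨hy.1.trans (hhl y ⟨hy.1, hyp⟩), ((hhm hyp.le).trans_eq hhp).trans_lt hpr⟩
      · rw [hhp]; exact hy
      · exact ⟨hlp.trans_le (hhp.symm.trans_le (hhm hyp.le)), (hhr y ⟨hyp, hy.2⟩).trans hy.2⟩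
    · simp only [hh, hf, coe_sub_int, plpdm_iterate_coe]
  · rintro _ ⟨y, hy, rfl⟩
    simp only [hf, plpdm_iterate_mul_coe c b y n' _ m']
    refine ((AddCircle.continuous_mk' 1).tendsto p).comp ?_
    rcases lt_trichotomy y p with hyp | rfl | hyp
    · exact tendsto_iterate_of_lt_left hhc hhm hhp hhl ⟨hy.1, hyp⟩
    · change Tendsto (fun k => h^[k] y) atTop (𝓝 y)
      simp only [Function.iterate_fixed hhp]
      exact tendsto_const_nhds
    · exact tendsto_iterate_of_lt_right hhc hhm hhp hhr ⟨hyp, hy.2⟩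

/-- The domain of attraction of an attracting periodic point is not the whole circle. -/
lemma exists_notMem_of_attracting {c b x : ℝ} {n : ℕ} (hn : 0 < n) {U : Set UnitAddCircle}
    (hx : (plpdm (c : UnitAddCircle) b)^[n] (x : UnitAddCircle) = x)
    (hU : ∀ y ∈ U, Tendsto (fun k => (plpdm (c : UnitAddCircle) b)^[n * k] y) atTop
      (𝓝 (x : UnitAddCircle))) :
    ∃ w ∈ Ioo x (x + 1), ((w : ℝ) : UnitAddCircle) ∉ U := by
  by_contra! hall
  set f := plpdm (c : UnitAddCircle) b with hf
  have hx2 : f^[n * 2] (x : UnitAddCircle) = x := by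
    rw [mul_two, Function.iterate_add_apply, hx, hx]
  obtain ⟨M, hM⟩ : ∃ M : ℤ, (lift c b)^[n * 2] x = x + M := by
    rwa [hf, plpdm_iterate_coe, coe_eq_coe_iff] at hx2
  have hM1 := lift_iterate_add_int c b x 1 (n * 2)
  push_cast at hM1
  have h4 : (4 : ℝ) ≤ 2 ^ (n * 2) := by
    calc (4 : ℝ) = 2 ^ 2 := by norm_num
      _ ≤ _ := pow_le_pow_right₀ (by norm_num) (by lia)
  obtain ⟨y, hy, hy1⟩ : (1 : ℝ) ∈ (fun y => (lift c b)^[n * 2] y - y - M) '' Ioo x (x + 1) := by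
    refine intermediate_value_Ioo (by linarith)
      (Continuous.continuousOn ?_) ⟨?_, ?_⟩
    · have := continuous_lift_iterate c b (n * 2)
      fun_prop
    · simp only [hM]; linarith
    · simp only [hM1, hM]; linarith
  have hfy : f^[n * 2] (y : UnitAddCircle) = y := by
    rw [hf, plpdm_iterate_coe, coe_eq_coe_iff]
    exact ⟨M + 1, by push_cast; linarith⟩
  have ht := (hU y (hall y hy)).comp
    (tendsto_atTop_mono (fun k : ℕ => (by lia : k ≤ 2 * k)) tendsto_id)
  have hconst : ((fun k => f^[n * k] (y : UnitAddCircle)) ∘ fun k => 2 * k) = fun _ => ↑y := by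
    funext k
    rw [Function.comp_apply, ← mul_assoc, Function.iterate_mul, Function.iterate_fixed hfy]
  rw [hconst] at ht
  obtain ⟨j, hj⟩ := coe_eq_coe_iff.1 (tendsto_nhds_unique tendsto_const_nhds ht)
  have h1 : (0 : ℝ) < j := by linarith [hy.1]
  have h2 : (j : ℝ) < 1 := by linarith [hy.2]
  norm_cast at h1 h2
  lia

lemma exists_tendsto_iterate_of_le {g : ℝ → ℝ} (hc : Continuous g) (hm : Monotone g) {x y w : ℝ}
    {P : Set ℝ} (hP : MapsTo g P P) (hw : w ∉ P) (hxw : x < w) (hx : g x = x) (hxy : x < y)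
    (hyP : Icc x y ⊆ P) (hy : y ≤ g y) :
    ∃ L ∈ Icc y w, Tendsto (fun k => g^[k] y) atTop (𝓝 L) := by
  have hmono : Monotone fun k => g^[k] y := hm.monotone_iterate_of_le_map hy
  have hup : ∀ k, g^[k] y ≤ w := fun k => by
    by_contra! hlt
    obtain ⟨z, hz, hzw⟩ := intermediate_value_Icc hxy.le (hc.iterate k).continuousOn
      (show w ∈ Icc (g^[k] x) (g^[k] y) from
        ⟨by rw [Function.iterate_fixed hx]; exact hxw.le, hlt.le⟩)
    exact hw (hzw ▸ hP.iterate k (hyP hz))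
  have hb : BddAbove (range fun k => g^[k] y) := ⟨w, by rintro _ ⟨k, rfl⟩; exact hup k⟩
  exact ⟨_, ⟨le_ciSup hb 0, ciSup_le hup⟩, tendsto_atTop_ciSup hmono hb⟩

lemma exists_tendsto_iterate_of_ge {g : ℝ → ℝ} (hc : Continuous g) (hm : Monotone g) {x y w : ℝ}
    {P : Set ℝ} (hP : MapsTo g P P) (hw : w ∉ P) (hxw : w < x) (hx : g x = x) (hxy : y < x)
    (hyP : Icc y x ⊆ P) (hy : g y ≤ y) :
    ∃ L ∈ Icc w y, Tendsto (fun k => g^[k] y) atTop (𝓝 L) := by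
  have hsemi : ∀ k t, (fun s => -g (-s))^[k] t = -g^[k] (-t) := fun k t => by
    induction k with
    | zero => simp
    | succ k ih => rw [Function.iterate_succ_apply', Function.iterate_succ_apply', ih, neg_neg]
  obtain ⟨L, hL, ht⟩ := exists_tendsto_iterate_of_le (g := fun s => -g (-s)) (x := -x) (y := -y)
    (w := -w) (P := {s | -s ∈ P}) (by fun_prop)
    (fun s t hst => neg_le_neg (hm (neg_le_neg hst)))
    (fun s hs => by simpa using hP hs) (by simpa using hw) (neg_lt_neg hxw) (by simp [hx])
    (neg_lt_neg hxy) (fun s hs => hyP ⟨by linarith [hs.2], by linarith [hs.1]⟩) (by simpa using hy)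
  exact ⟨-L, ⟨by linarith [hL.2], by linarith [hL.1]⟩, by simpa [hsemi] using ht.neg⟩

lemma lift_of_attracting {c b x : ℝ} (hb : |b| < 1) {n : ℕ}
    (h : IsAttractingPeriodicPt (plpdm (c : UnitAddCircle) b) n (x : UnitAddCircle)) :
    ∃ m : ℤ, (lift c b)^[n] x - m = x ∧ ∃ ε > 0,
      (∀ y ∈ Ioo (x - ε) x, y < (lift c b)^[n] y - m) ∧
      ∀ y ∈ Ioo x (x + ε), (lift c b)^[n] y - m < y := by
  obtain ⟨hn, hx, -, U, hUo, -, hxU, hfU, hU⟩ := h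
  obtain ⟨m, hm⟩ : ∃ m : ℤ, (lift c b)^[n] x = x + m := by
    rwa [plpdm_iterate_coe, coe_eq_coe_iff] at hx
  obtain ⟨w, hw, hwU⟩ := exists_notMem_of_attracting hn hx hU
  set g : ℝ → ℝ := fun t => (lift c b)^[n] t - m with hg
  have hgc : Continuous g := (continuous_lift_iterate c b n).sub continuous_const
  have hgm : Monotone g := fun s t hst =>
    sub_le_sub_right ((lift_iterate_strictMono c hb n).monotone hst) _
  have hgx : g x = x := by simp [hg, hm]
  have hcont : Continuous fun t : ℝ => (t : UnitAddCircle) := AddCircle.continuous_mk' 1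
  set P : Set ℝ := (fun t : ℝ => (t : UnitAddCircle)) ⁻¹' U with hPdef
  have hP : MapsTo g P P := fun t ht => by
    have := hfU ⟨_, ht, rfl⟩
    simpa only [hPdef, mem_preimage, hg, coe_sub_int, ← plpdm_iterate_coe] using this
  have hw' : w - 1 ∉ P := by
    have := coe_sub_int w 1
    push_cast at this
    simpa only [hPdef, mem_preimage, this] using hwU
  obtain ⟨ε, hε, hεP⟩ := Metric.isOpen_iff.1 (hUo.preimage hcont) x hxU
  rw [Real.ball_eq_Ioo] at hεP
  have hlim : ∀ y ∈ P, ∀ L, Tendsto (fun k => g^[k] y) atTop (𝓝 L) → ∃ j : ℤ, L = x + j := by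
    intro y hy L hL
    have h1 := hU _ hy
    simp only [plpdm_iterate_mul_coe c b y n _ m] at h1
    exact coe_eq_coe_iff.1 (tendsto_nhds_unique ((hcont.tendsto L).comp hL) h1)
  refine ⟨m, hgx, ε, hε, fun y hy => ?_, fun y hy => ?_⟩
  · by_contra! hle
    have hsub : Icc y x ⊆ P := fun z hz => hεP ⟨by linarith [hz.1, hy.1], by linarith [hz.2]⟩
    obtain ⟨L, hL, ht⟩ := exists_tendsto_iterate_of_ge hgc hgm hP hw' (by linarith [hw.2]) hgx
      hy.2 hsub hle
    obtain ⟨j, hj⟩ := hlim y (hsub ⟨le_rfl, hy.2.le⟩) L ht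
    have h1 : (-1 : ℝ) < j := by linarith [hL.1, hw.1]
    have h2 : (j : ℝ) < 0 := by linarith [hL.2, hy.2]
    norm_cast at h1 h2
    lia
  · by_contra! hle
    have hsub : Icc x y ⊆ P := fun z hz => hεP ⟨by linarith [hz.1], by linarith [hz.2, hy.2]⟩
    obtain ⟨L, hL, ht⟩ := exists_tendsto_iterate_of_le hgc hgm hP hwU hw.1 hgx hy.1 hsub hle
    obtain ⟨j, hj⟩ := hlim y (hsub ⟨hy.1.le, le_rfl⟩) L ht
    have h1 : (0 : ℝ) < j := by linarith [hL.1, hy.1]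
    have h2 : (j : ℝ) < 1 := by linarith [hL.2, hw.2]
    norm_cast at h1 h2
    lia

lemma exists_last_crossing {g : ℝ → ℝ} (hc : Continuous g) {l r : ℝ} (hlr : l ≤ r) (hl : l < g l)
    (hr : g r < r) : ∃ p ∈ Ioo l r, g p = p ∧ (∀ y ∈ Ioc p r, g y ≤ y) ∧
      ∀ z < p, ∃ y ∈ Ioo z p, y < g y := by
  set A : Set ℝ := {y | y ∈ Icc l r ∧ y < g y} with hA
  have hlA : l ∈ A := ⟨⟨le_rfl, hlr⟩, hl⟩
  have hbdd : BddAbove A := ⟨r, fun y hy => hy.1.2⟩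
  set p := sSup A with hpdef
  have hpcl : p ∈ closure A := csSup_mem_closure ⟨l, hlA⟩ hbdd
  have hsub : closure A ⊆ {y | y ∈ Icc l r ∧ y ≤ g y} :=
    closure_minimal (fun y hy => ⟨hy.1, hy.2.le⟩)
      (isClosed_Icc.inter (isClosed_le continuous_id hc))
  obtain ⟨hpI, hple⟩ := hsub hpcl
  have hpr : p < r := lt_of_le_of_ne hpI.2 fun h => by rw [h] at hple; linarith
  have hright : ∀ y ∈ Ioc p r, g y ≤ y := fun y hy => by
    by_contra! h
    exact (le_csSup hbdd ⟨⟨hpI.1.trans hy.1.le, hy.2⟩, h⟩).not_gt hy.1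
  have hpge : g p ≤ p := by
    have : ∀ᶠ y in 𝓝[>] p, g y ≤ y := by
      filter_upwards [Ioc_mem_nhdsGT hpr] with y hy using hright y hy
    exact le_of_tendsto_of_tendsto (hc.continuousWithinAt (s := Ioi p)) continuousWithinAt_id this
  have hfix := le_antisymm hpge hple
  have hpl : l < p := lt_of_le_of_ne hpI.1 fun h => by rw [← h] at hfix; linarith
  refine ⟨p, ⟨hpl, hpr⟩, hfix, hright, fun z hz => ?_⟩
  obtain ⟨y, hy, hzy⟩ := exists_lt_of_lt_csSup ⟨l, hlA⟩ hz
  refine ⟨y, ⟨hzy, lt_of_le_of_ne (le_csSup hbdd hy) fun h => ?_⟩, hy.2⟩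
  have := hy.2
  rw [h, hfix] at this
  exact lt_irrefl _ this

/-- Only finitely many `b` allow a product of `n` slopes `2 ± 2b` to equal `1`. -/
lemma finite_slope_eq_one {n : ℕ} (hn : 0 < n) :
    {b : ℝ | ∃ i ≤ n, (2 + 2 * b) ^ i * (2 - 2 * b) ^ (n - i) = 1}.Finite := by
  open Polynomial in
  have hfin : ∀ i ≤ n, {b : ℝ | (2 + 2 * b) ^ i * (2 - 2 * b) ^ (n - i) = 1}.Finite := by
    intro i hi
    set q : ℝ[X] := (2 + 2 * X) ^ i * (2 - 2 * X) ^ (n - i) - 1 with hq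
    have heval : ∀ b : ℝ, q.eval b = (2 + 2 * b) ^ i * (2 - 2 * b) ^ (n - i) - 1 := by
      intro b
      simp [hq]
    have hq0 : q ≠ 0 := by
      intro h0
      rcases Nat.eq_zero_or_pos i with rfl | hi0
      · have := heval 1
        simp [h0, hn.ne'] at this
      · have := heval (-1)
        simp [h0, hi0.ne'] at this
    refine (q.rootSet_finite ℝ).subset fun b hb => ?_
    rw [Set.mem_ofPred_eq] at hb
    rw [mem_rootSet]
    exact ⟨hq0, by simp [coe_aeval_eq_eval, heval, hb]⟩
  refine ((Set.finite_le_nat n).biUnion fun i hi => hfin i hi).subset ?_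
  rintro b ⟨i, hi, h⟩
  exact mem_biUnion hi h

lemma eventually_attracting {c₀ b₀ : ℝ} (hb₀ : |b₀| < 1) {n : ℕ} {x : ℝ}
    (h : IsAttractingPeriodicPt (plpdm (c₀ : UnitAddCircle) b₀) n (x : UnitAddCircle)) :
    ∀ᶠ q : ℝ × ℝ in 𝓝 (c₀, b₀),
      ∃ n x, IsAttractingPeriodicPt (plpdm (q.1 : UnitAddCircle) q.2) n x := by
  have hn : 0 < n := h.1
  obtain ⟨m, hm, ε, hε, hleft, hright⟩ := lift_of_attracting hb₀ h
  obtain ⟨δR, hδR, i, -, HR⟩ := lift_iterate_affine_right hb₀ c₀ x n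
  obtain ⟨δL, hδL, sL, HL⟩ := lift_iterate_affine_left hb₀ c₀ x n
  set sR := (2 + 2 * b₀) ^ i * (2 - 2 * b₀) ^ (n - i)
  have hnearGT : ∀ᶠ r in 𝓝[>] x, r ∈ Ioo x (x + ε) := Ioo_mem_nhdsGT (by linarith)
  obtain ⟨r, hrI, hr⟩ := (hnearGT.and
    ((eventually_lift_iterate_close c₀ b₀ x n hδR).filter_mono nhdsWithin_le_nhds)).exists
  have hnearLT : ∀ᶠ l in 𝓝[<] x, l ∈ Ioo (x - ε) x := Ioo_mem_nhdsLT (by linarith)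
  obtain ⟨l, hlI, hl⟩ := (hnearLT.and
    ((eventually_lift_iterate_close c₀ b₀ x n hδL).filter_mono nhdsWithin_le_nhds)).exists
  have hsR : sR < 1 := by
    have h1 := HR c₀ le_rfl r (fun k hk => by linarith [(abs_lt.1 (hr k hk)).2]) r
      ⟨hrI.1.le, le_rfl⟩
    have h2 := hright r hrI
    by_contra! hs
    nlinarith [mul_nonneg (sub_nonneg.2 hs) (sub_nonneg.2 hrI.1.le)]
  have hsL : sL < 1 := by
    have h1 := HL c₀ le_rfl l (fun k hk => by linarith [(abs_lt.1 (hl k hk)).1]) l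
      ⟨le_rfl, hlI.2.le⟩
    have h2 := hleft l hlI
    by_contra! hs
    nlinarith [mul_nonneg (sub_nonneg.2 hs) (sub_nonneg.2 hlI.2.le)]
  have hcont := fun (t : ℝ) (k : ℕ) => (continuous_param_lift_iterate t k).tendsto (c₀, b₀)
  have hsnd : Tendsto (fun q : ℝ × ℝ => q.2) (𝓝 (c₀, b₀)) (𝓝 b₀) := continuous_snd.tendsto _
  have e1 : ∀ᶠ q : ℝ × ℝ in 𝓝 (c₀, b₀), |q.2| < 1 := hsnd.abs.eventually_lt_const hb₀
  have e2 : ∀ᶠ q : ℝ × ℝ in 𝓝 (c₀, b₀),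
      q.2 ∉ {b : ℝ | ∃ i ≤ n, (2 + 2 * b) ^ i * (2 - 2 * b) ^ (n - i) = 1} \ {b₀} :=
    hsnd.eventually
      (((finite_slope_eq_one hn).subset sdiff_subset).isClosed.isOpen_compl.mem_nhds (by simp))
  have e3 : ∀ᶠ q : ℝ × ℝ in 𝓝 (c₀, b₀), (lift q.1 q.2)^[n] r < r + m :=
    (hcont r n).eventually_lt_const (by linarith [hright r hrI])
  have e4 : ∀ᶠ q : ℝ × ℝ in 𝓝 (c₀, b₀), l + m < (lift q.1 q.2)^[n] l :=
    (hcont l n).eventually_const_lt (by linarith [hleft l hlI])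
  have e5 : ∀ᶠ q : ℝ × ℝ in 𝓝 (c₀, b₀), ∀ k ∈ Finset.range n,
      (lift q.1 q.2)^[k] r < (lift c₀ b₀)^[k] x + δR := by
    rw [Filter.eventually_all_finset]
    exact fun k hk => (hcont r k).eventually_lt_const
      (by linarith [(abs_lt.1 (hr k (Finset.mem_range.1 hk))).2])
  have e6 : ∀ᶠ q : ℝ × ℝ in 𝓝 (c₀, b₀), ∀ k ∈ Finset.range n,
      (lift c₀ b₀)^[k] x - δL < (lift q.1 q.2)^[k] l := by
    rw [Filter.eventually_all_finset]
    exact fun k hk => (hcont l k).eventually_const_lt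
      (by linarith [(abs_lt.1 (hl k (Finset.mem_range.1 hk))).1])
  filter_upwards [e1, e2, e3, e4, e5, e6] with ⟨c, b⟩ hb hslope hgr hgl hR hL
  dsimp only at hb hslope hgr hgl hR hL ⊢
  obtain ⟨p, hpI, hp, hpr, hpl⟩ := exists_last_crossing
    (g := fun t => (lift c b)^[n] t - m) ((continuous_lift_iterate c b n).sub continuous_const)
    (hlI.2.trans hrI.1).le (by linarith) (by linarith)
  have hleft' : ∃ z < p, ∀ y ∈ Ioo z p, y < (lift c b)^[n] y - m := by
    obtain ⟨z, hz, s, H⟩ := lift_iterate_affine_nhds_left hb c p n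
    obtain ⟨y, hy, hyg⟩ := hpl z hz
    rw [H y ⟨hy.1.le, hy.2.le⟩] at hyg
    have hs : s < 1 := by
      by_contra! hs
      nlinarith [mul_nonneg (sub_nonneg.2 hs) (sub_nonneg.2 hy.2.le)]
    refine ⟨z, hz, fun t ht => ?_⟩
    rw [H t ⟨ht.1.le, ht.2.le⟩]
    nlinarith [mul_pos (sub_pos.2 hs) (sub_pos.2 ht.2)]
  have hright' : ∃ z > p, ∀ y ∈ Ioo p z, (lift c b)^[n] y - m < y := by
    rcases eq_or_ne b b₀ with rfl | hne
    · rcases le_or_gt c₀ c with hc | hc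
      · have hxp : x ≤ p := by
          by_contra! hpx
          have := hleft p ⟨by linarith [hlI.1, hpI.1], hpx⟩
          linarith [lift_iterate_mono_param hb hc n p]
        have H := HR c hc r fun k hk => (hR k (Finset.mem_range.2 hk)).le
        refine ⟨r, hpI.2, fun y hy => ?_⟩
        have h1 := H p ⟨hxp, hpI.2.le⟩
        have h2 := H y ⟨hxp.trans hy.1.le, hy.2.le⟩
        nlinarith [mul_pos (sub_pos.2 hsR) (sub_pos.2 hy.1)]
      · have hpx : p < x := by
          by_contra! hxp
          have h1 : (lift c₀ b)^[n] p - m ≤ p := by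
            rcases hxp.eq_or_lt with rfl | hlt
            · exact hm.le
            · exact (hright p ⟨hlt, hpI.2.trans hrI.2⟩).le
          linarith [lift_iterate_strictMono_param hb hc hn p]
        have H := HL c hc.le l fun k hk => (hL k (Finset.mem_range.2 hk)).le
        refine ⟨x, hpx, fun y hy => ?_⟩
        have h1 := H p ⟨hpI.1.le, hpx.le⟩
        have h2 := H y ⟨hpI.1.le.trans hy.1.le, hy.2.le⟩
        nlinarith [mul_pos (sub_pos.2 hsL) (sub_pos.2 hy.1)]
    · obtain ⟨z, hz, j, hj, H⟩ := lift_iterate_affine_nhds_right hb c p n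
      set s := (2 + 2 * b) ^ j * (2 - 2 * b) ^ (n - j) with hs
      have hs1 : s ≠ 1 := fun hs1 => hslope ⟨⟨j, hj, hs1⟩, hne⟩
      have hs2 : s ≤ 1 := by
        have hlt : p < min z r := lt_min hz hpI.2
        have h1 := hpr (min z r) ⟨hlt, min_le_right _ _⟩
        rw [H _ ⟨hlt.le, min_le_left _ _⟩] at h1
        by_contra! hs
        nlinarith [mul_pos (sub_pos.2 hs) (sub_pos.2 hlt)]
      have hs3 : s < 1 := lt_of_le_of_ne hs2 hs1
      refine ⟨z, hz, fun y hy => ?_⟩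
      rw [H y ⟨hy.1.le, hy.2.le⟩]
      nlinarith [mul_pos (sub_pos.2 hs3) (sub_pos.2 hy.1)]
  obtain ⟨z, hz, hzl⟩ := hleft'
  obtain ⟨z', hz', hzr⟩ := hright'
  exact exists_attracting_of_lift hb hn hz hz' hp hzl hzr

lemma eventually_mem_hypSet {q : UnitAddCircle × ℝ} (hq : q ∈ hypSet) :
    ∀ᶠ q' in 𝓝 q, q'.2 ∈ Icc (0 : ℝ) 1 → q' ∈ hypSet := by
  obtain ⟨a, b₀⟩ := q
  obtain ⟨hb, n, X, h⟩ := hq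
  dsimp only at hb h
  induction a using QuotientAddGroup.induction_on with | H c₀ => ?_
  induction X using QuotientAddGroup.induction_on with | H x => ?_
  have hb1 : |b₀| < 1 := by rw [abs_of_nonneg hb.1]; exact hb.2
  have h1 := eventually_attracting hb1 h
  have hopen : IsOpenMap (Prod.map (fun t : ℝ => (t : UnitAddCircle)) (id : ℝ → ℝ)) :=
    QuotientAddGroup.isOpenMap_coe.prodMap IsOpenMap.id
  have h2 : ∀ᶠ q : UnitAddCircle × ℝ in 𝓝 ((c₀ : UnitAddCircle), b₀),
      ∃ n x, IsAttractingPeriodicPt (plpdm q.1 q.2) n x := by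
    filter_upwards [hopen.image_mem_nhds h1]
    rintro _ ⟨q, hq, rfl⟩
    exact hq
  have h3 : ∀ᶠ q : UnitAddCircle × ℝ in 𝓝 ((c₀ : UnitAddCircle), b₀), q.2 < 1 :=
    (continuous_snd.tendsto _).eventually_lt_const hb.2
  filter_upwards [h2, h3] with q' hq hlt hI
  exact ⟨⟨hI.1, hlt⟩, hq⟩

end PlpdmOpen

theorem stmt10 : ∃ V : Set (UnitAddCircle × ℝ), IsOpen V ∧
    hypSet = V ∩ {q : UnitAddCircle × ℝ | q.2 ∈ Set.Icc (0:ℝ) 1} := by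
  refine ⟨interior {q | q.2 ∈ Icc (0 : ℝ) 1 → q ∈ hypSet}, isOpen_interior, ?_⟩
  ext q
  refine ⟨fun hq => ⟨?_, hq.1.1, hq.1.2.le⟩, fun hq => interior_subset hq.1 hq.2⟩
  exact mem_interior_iff_mem_nhds.2 (PlpdmOpen.eventually_mem_hypSet hq)
end

section
/- Let σ be a single minus periodic slope itinerary of period p with σ_0 = −, and let S be a connected component of the set of parameters (a,b) ∈ ℝ/ℤ × [0,1) such that f_{a,b} has an attracting periodic orbit with slope itinerary σ. For (a,b) ∈ S let x₀(a,b) denote the unique point of the attracting orbit lying in I_−. Then the map (a,b) ↦ φ_{a,b}(x₀(a,b)) is constant on S, and its constant value is of the form k/(2^p − 1) mod 1 for some integer 0 ≤ k ≤ 2^p − 2. -/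
open Set Filter Topology

/-- The lift `x ↦ 2x + α + (b/2) S(x)` of the circle map with parameters `(α mod 1, b)`,
where `S` is written through the distance to the nearest integer. -/
noncomputable def realLift (α b u : ℝ) : ℝ :=
  2 * u + α + (b / 2) * (4 * ‖(u : UnitAddCircle)‖ - 1)

/-- The orbit of `u` under `realLift α b` starts in a lift of the open arc `(1/2, 1)`, and its
points of index `0 < j < p` lie in lifts of the open arc `(0, 1/2)`. -/
def HasSingleMinusItinerary (α b : ℝ) (p : ℕ) (u : ℝ) : Prop :=
  (∃ n : ℤ, u ∈ Ioo (n + 1 / 2 : ℝ) (n + 1)) ∧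
    ∀ j : ℕ, 0 < j → j < p → ∃ n : ℤ, (realLift α b)^[j] u ∈ Ioo (n : ℝ) (n + 1 / 2)

lemma rep_coe (u : ℝ) : rep (u : UnitAddCircle) = Int.fract u := by
  simp [rep]

lemma coe_rep (z : UnitAddCircle) : ((rep z : ℝ) : UnitAddCircle) = z :=
  (AddCircle.equivIco 1 0).symm_apply_apply z

lemma Sfun_fract (u : ℝ) : Sfun (Int.fract u) = 4 * ‖(u : UnitAddCircle)‖ - 1 := by
  rw [UnitAddCircle.norm_eq, abs_sub_round_eq_min, Sfun]
  split_ifs with h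
  · rw [min_eq_left (by linarith)]
  · rw [min_eq_right (by linarith)]; ring

lemma coe_add_intCast (u : ℝ) (n : ℤ) : ((u + n : ℝ) : UnitAddCircle) = u := by
  have h : ((n : ℝ) : UnitAddCircle) = 0 := by
    rw [AddCircle.coe_eq_zero_iff]; exact ⟨n, by simp⟩
  rw [AddCircle.coe_add, h, add_zero]

lemma coe_eq_coe_iff_exists_int {u v : ℝ} :
    (u : UnitAddCircle) = v ↔ ∃ n : ℤ, u = v + n := by
  constructor
  · intro h
    have h0 : ((u - v : ℝ) : UnitAddCircle) = 0 := by rw [AddCircle.coe_sub, h, sub_self]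
    obtain ⟨n, hn⟩ := (AddCircle.coe_eq_zero_iff (1 : ℝ)).1 h0
    exact ⟨n, by simp at hn; linarith⟩
  · rintro ⟨n, rfl⟩
    exact coe_add_intCast v n

lemma plpdm_coe (α b u : ℝ) : plpdm α b u = (realLift α b u : UnitAddCircle) := by
  rw [plpdm, rep_coe, Sfun_fract, ← AddCircle.coe_add, coe_eq_coe_iff_exists_int]
  refine ⟨-(2 * ⌊u⌋), ?_⟩
  have h := Int.floor_add_fract u
  rw [realLift]
  push_cast
  linarith

lemma plpdm_iterate_coe (α b u : ℝ) (j : ℕ) :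
    (plpdm α b)^[j] u = ((realLift α b)^[j] u : UnitAddCircle) := by
  induction j with
  | zero => rfl
  | succ j ih => rw [Function.iterate_succ_apply', ih, plpdm_coe, Function.iterate_succ_apply']

lemma liftF_eq (a : UnitAddCircle) (b : ℝ) : ∃ c : ℤ, liftF a b = realLift (rep a + c) b := by
  refine ⟨if rep a - b / 2 < 0 then 1 else 0, ?_⟩
  funext x
  have h := Int.floor_add_fract x
  rw [liftF, realLift, Sfun_fract]
  push_cast
  linarith

lemma continuous_coe_unitAddCircle : Continuous fun u : ℝ => (u : UnitAddCircle) :=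
  AddCircle.continuous_mk' 1

lemma isOpenMap_coe_unitAddCircle : IsOpenMap fun u : ℝ => (u : UnitAddCircle) :=
  QuotientAddGroup.isOpenMap_coe

lemma continuous_realLift_iterate (j : ℕ) :
    Continuous fun q : (ℝ × ℝ) × ℝ => (realLift q.1.1 q.1.2)^[j] q.2 := by
  induction j with
  | zero => exact continuous_snd
  | succ j ih =>
    simp only [Function.iterate_succ_apply', realLift]
    have h := continuous_coe_unitAddCircle.comp ih
    simp only [Function.comp_def] at h
    fun_prop

lemma continuous_realLift_iterate_right (α b : ℝ) (j : ℕ) : Continuous (realLift α b)^[j] :=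
  (continuous_realLift_iterate j).comp (Continuous.prodMk_right ((α, b) : ℝ × ℝ))

lemma continuous_realLift_iterate_left (u : ℝ) (j : ℕ) :
    Continuous fun q : ℝ × ℝ => (realLift q.1 q.2)^[j] u :=
  (continuous_realLift_iterate j).comp (Continuous.prodMk_left u)

lemma realLift_add_intCast (α b u : ℝ) (n : ℤ) :
    realLift α b (u + n) = realLift α b u + 2 * n := by
  rw [realLift, realLift, coe_add_intCast]; ring

lemma realLift_iterate_add_intCast (α b u : ℝ) (n : ℤ) (j : ℕ) :
    (realLift α b)^[j] (u + n) = (realLift α b)^[j] u + 2 ^ j * n := by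
  induction j with
  | zero => simp
  | succ j ih =>
    have h := realLift_add_intCast α b ((realLift α b)^[j] u) (2 ^ j * n)
    push_cast at h
    rw [Function.iterate_succ_apply', ih, h, Function.iterate_succ_apply']
    ring

lemma realLift_iterate_add_param (α b u : ℝ) (e : ℤ) (j : ℕ) :
    (realLift (α + e) b)^[j] u = (realLift α b)^[j] u + (2 ^ j - 1) * e := by
  induction j with
  | zero => simp
  | succ j ih =>
    have h := realLift_add_intCast α b ((realLift α b)^[j] u) ((2 ^ j - 1) * e)
    have h' : ∀ v, realLift (α + e) b v = realLift α b v + e := by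
      intro v; rw [realLift, realLift]; ring
    push_cast at h
    rw [Function.iterate_succ_apply', ih, h', h, Function.iterate_succ_apply']
    ring

lemma norm_coe_le_abs (u : ℝ) : ‖(u : UnitAddCircle)‖ ≤ |u| := by
  rw [UnitAddCircle.norm_eq]
  simpa using round_le u 0

lemma realLift_strictMono (α : ℝ) {b : ℝ} (hb : b ∈ Ico (0 : ℝ) 1) :
    StrictMono (realLift α b) := by
  intro u v huv
  have h1 : ‖(u : UnitAddCircle)‖ - ‖(v : UnitAddCircle)‖ ≤ v - u := by
    calc ‖(u : UnitAddCircle)‖ - ‖(v : UnitAddCircle)‖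
        ≤ ‖(u : UnitAddCircle) - v‖ := norm_sub_norm_le _ _
      _ = ‖((u - v : ℝ) : UnitAddCircle)‖ := by rw [AddCircle.coe_sub]
      _ ≤ |u - v| := norm_coe_le_abs _
      _ = v - u := by rw [abs_sub_comm, abs_of_pos (by linarith)]
  have h2 : 2 * b * (‖(u : UnitAddCircle)‖ - ‖(v : UnitAddCircle)‖) ≤ 2 * b * (v - u) :=
    mul_le_mul_of_nonneg_left h1 (by linarith [hb.1])
  have h3 : 0 < (1 - b) * (v - u) := mul_pos (by linarith [hb.2]) (by linarith)
  rw [realLift, realLift]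
  nlinarith

lemma norm_coe_eq_min {n : ℤ} {u : ℝ} (h0 : (n : ℝ) ≤ u) (h1 : u < n + 1) :
    ‖(u : UnitAddCircle)‖ = min (u - n) (1 - (u - n)) := by
  have hf : ⌊u⌋ = n := Int.floor_eq_iff.2 ⟨h0, h1⟩
  rw [UnitAddCircle.norm_eq, abs_sub_round_eq_min, Int.fract, hf]

lemma realLift_sub_of_mem_minus (α b : ℝ) {n : ℤ} {u v : ℝ}
    (hu : u ∈ Ioo (n + 1 / 2 : ℝ) (n + 1)) (hv : v ∈ Ioo (n + 1 / 2 : ℝ) (n + 1)) :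
    realLift α b v - realLift α b u = (2 - 2 * b) * (v - u) := by
  rw [realLift, realLift, norm_coe_eq_min (n := n) (by linarith [hu.1]) hu.2,
    norm_coe_eq_min (n := n) (by linarith [hv.1]) hv.2,
    min_eq_right (by linarith [hv.1]), min_eq_right (by linarith [hu.1])]
  ring

lemma realLift_sub_of_mem_plus (α b : ℝ) {n : ℤ} {u v : ℝ}
    (hu : u ∈ Ioo (n : ℝ) (n + 1 / 2)) (hv : v ∈ Ioo (n : ℝ) (n + 1 / 2)) :
    realLift α b v - realLift α b u = (2 + 2 * b) * (v - u) := by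
  rw [realLift, realLift, norm_coe_eq_min (n := n) hu.1.le (by linarith [hu.2]),
    norm_coe_eq_min (n := n) hv.1.le (by linarith [hv.2]),
    min_eq_left (by linarith [hv.2]), min_eq_left (by linarith [hu.2])]
  ring

lemma HasSingleMinusItinerary.eventually_iterate_sub {α b u : ℝ} {p : ℕ}
    (h : HasSingleMinusItinerary α b p u) {j : ℕ} (hj : j < p) :
    ∀ᶠ v in 𝓝 u, (realLift α b)^[j + 1] v - (realLift α b)^[j + 1] u
      = (2 - 2 * b) * (2 + 2 * b) ^ j * (v - u) := by
  induction j with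
  | zero =>
    obtain ⟨n, hn⟩ := h.1
    filter_upwards [isOpen_Ioo.mem_nhds hn] with v hv
    simpa using realLift_sub_of_mem_minus α b hn hv
  | succ j ih =>
    obtain ⟨n, hn⟩ := h.2 (j + 1) j.succ_pos hj
    filter_upwards [ih (by omega), (continuous_realLift_iterate_right α b (j + 1)).continuousAt
      (isOpen_Ioo.mem_nhds hn)] with v h1 h2
    rw [Function.iterate_succ_apply' _ (j + 1) v, Function.iterate_succ_apply' _ (j + 1) u,
      realLift_sub_of_mem_plus α b hn h2, h1]
    ring

lemma HasSingleMinusItinerary.eventually_prod {α b u : ℝ} {p : ℕ}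
    (h : HasSingleMinusItinerary α b p u) :
    ∀ᶠ q : (ℝ × ℝ) × ℝ in 𝓝 ((α, b), u), HasSingleMinusItinerary q.1.1 q.1.2 p q.2 := by
  refine Filter.Eventually.and ?_ ?_
  · obtain ⟨n, hn⟩ := h.1
    filter_upwards [continuous_snd.continuousAt (isOpen_Ioo.mem_nhds hn)] with q hq
    exact ⟨n, hq⟩
  · have hall : ∀ᶠ q : (ℝ × ℝ) × ℝ in 𝓝 ((α, b), u), ∀ j ∈ Finset.range p, 0 < j →
        ∃ n : ℤ, (realLift q.1.1 q.1.2)^[j] q.2 ∈ Ioo (n : ℝ) (n + 1 / 2) := by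
      rw [Filter.eventually_all_finset]
      intro j hj
      by_cases hj0 : 0 < j
      · obtain ⟨n, hn⟩ := h.2 j hj0 (Finset.mem_range.1 hj)
        filter_upwards [(continuous_realLift_iterate j).continuousAt
          (x := ((α, b), u)) (isOpen_Ioo.mem_nhds hn)] with q hq
        exact fun _ => ⟨n, hq⟩
      · exact Filter.Eventually.of_forall fun q hq => absurd hq hj0
    filter_upwards [hall] with q hq j hj0 hj
    exact hq j (Finset.mem_range.2 hj) hj0

lemma not_lt_of_hasSingleMinusItinerary {α b : ℝ} (hb : b ∈ Ico (0 : ℝ) 1) {p : ℕ} (hp : 0 < p)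
    (hs : (2 - 2 * b) * (2 + 2 * b) ^ (p - 1) < 1) {u v : ℝ}
    (hu : u ∈ Ioo (1 / 2 : ℝ) 1) (hv : v ∈ Ioo (1 / 2 : ℝ) 1)
    (hiu : HasSingleMinusItinerary α b p u) (hiv : HasSingleMinusItinerary α b p v) {m m' : ℤ}
    (hmu : (realLift α b)^[p] u = u + m) (hmv : (realLift α b)^[p] v = v + m') : ¬ u < v := by
  intro huv
  have hb0 := hb.1
  have hb1 := hb.2
  have hpos : ∀ j : ℕ, 0 < (2 - 2 * b) * (2 + 2 * b) ^ j := fun j =>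
    mul_pos (by linarith) (pow_pos (by linarith) j)
  have key : ∀ j : ℕ, j < p → (realLift α b)^[j + 1] v - (realLift α b)^[j + 1] u
      = (2 - 2 * b) * (2 + 2 * b) ^ j * (v - u) := by
    intro j
    induction j with
    | zero =>
      intro _
      have := realLift_sub_of_mem_minus α b (n := 0) (u := u) (v := v)
        (by simpa using hu) (by simpa using hv)
      simpa using this
    | succ j ih =>
      intro hj
      have ih := ih (by omega)
      obtain ⟨n, hn⟩ := hiu.2 (j + 1) j.succ_pos hj
      obtain ⟨n', hn'⟩ := hiv.2 (j + 1) j.succ_pos hj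
      have hle : (2 - 2 * b) * (2 + 2 * b) ^ j ≤ 1 := by
        refine le_trans ?_ hs.le
        exact mul_le_mul_of_nonneg_left (pow_le_pow_right₀ (by linarith) (by omega))
          (by linarith)
      have hd0 : 0 < (2 - 2 * b) * (2 + 2 * b) ^ j * (v - u) :=
        mul_pos (hpos j) (by linarith)
      have hd1 : (2 - 2 * b) * (2 + 2 * b) ^ j * (v - u) < 1 / 2 := by
        have := mul_le_mul_of_nonneg_right hle (sub_nonneg.2 huv.le)
        linarith [hu.1, hv.2]
      obtain ⟨hn0, hn1⟩ := hn
      obtain ⟨hn0', hn1'⟩ := hn'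
      have e1 : n < n' + 1 := by
        have : (n : ℝ) < n' + 1 := by linarith
        exact_mod_cast this
      have e2 : n' < n + 1 := by
        have : (n' : ℝ) < n + 1 := by linarith
        exact_mod_cast this
      obtain rfl : n' = n := by omega
      rw [Function.iterate_succ_apply' _ (j + 1) v, Function.iterate_succ_apply' _ (j + 1) u,
        realLift_sub_of_mem_plus α b ⟨hn0, hn1⟩ ⟨hn0', hn1'⟩, ih]
      ring
  have hk := key (p - 1) (by omega)
  rw [Nat.sub_add_cancel hp, hmu, hmv] at hk
  have h0 : 0 < (2 - 2 * b) * (2 + 2 * b) ^ (p - 1) * (v - u) :=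
    mul_pos (hpos _) (by linarith)
  have h1 : (2 - 2 * b) * (2 + 2 * b) ^ (p - 1) * (v - u) < v - u := by
    have := mul_lt_mul_of_pos_right hs (sub_pos.2 huv)
    linarith
  have e1 : m' - m < 0 := by
    have : (m' : ℝ) - m < 0 := by linarith
    exact_mod_cast this
  have e2 : -1 < m' - m := by
    have : (-1 : ℝ) < m' - m := by linarith [hu.1, hv.2]
    exact_mod_cast this
  omega

lemma eq_of_hasSingleMinusItinerary {α b : ℝ} (hb : b ∈ Ico (0 : ℝ) 1) {p : ℕ} (hp : 0 < p)
    (hs : (2 - 2 * b) * (2 + 2 * b) ^ (p - 1) < 1) {u v : ℝ}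
    (hu : u ∈ Ioo (1 / 2 : ℝ) 1) (hv : v ∈ Ioo (1 / 2 : ℝ) 1)
    (hiu : HasSingleMinusItinerary α b p u) (hiv : HasSingleMinusItinerary α b p v) {m m' : ℤ}
    (hmu : (realLift α b)^[p] u = u + m) (hmv : (realLift α b)^[p] v = v + m') : u = v :=
  le_antisymm
    (not_lt.1 (not_lt_of_hasSingleMinusItinerary hb hp hs hv hu hiv hiu hmv hmu))
    (not_lt.1 (not_lt_of_hasSingleMinusItinerary hb hp hs hu hv hiu hiv hmu hmv))

lemma IsAttractingPeriodicPt.slope_lt_one {α b : ℝ} (hb : b ∈ Ico (0 : ℝ) 1) {p : ℕ} {u s : ℝ}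
    {m : ℤ} (hatt : IsAttractingPeriodicPt (plpdm α b) p u)
    (hm : (realLift α b)^[p] u = u + m)
    (haff : ∀ᶠ v in 𝓝 u, (realLift α b)^[p] v - (realLift α b)^[p] u = s * (v - u)) :
    s < 1 := by
  by_contra hs
  push Not at hs
  obtain ⟨-, -, -, U, hUo, -, hxU, -, hU⟩ := hatt
  have hexp : ∀ᶠ z : UnitAddCircle in 𝓝 (u : UnitAddCircle),
      ‖z - u‖ ≤ ‖(plpdm α b)^[p] z - u‖ := by
    have hmap : map (fun w : ℝ => (w : UnitAddCircle)) (𝓝 u) = 𝓝 (u : UnitAddCircle) :=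
      isOpenMap_coe_unitAddCircle.map_nhds_eq continuous_coe_unitAddCircle.continuousAt
    rw [← hmap, eventually_map]
    have hsmall : ∀ᶠ v in 𝓝 u, |s * (v - u)| < 1 / 2 := by
      have hc : Continuous fun v : ℝ => |s * (v - u)| := by fun_prop
      exact hc.continuousAt.eventually (gt_mem_nhds (by simp))
    filter_upwards [haff, hsmall] with v hv hv'
    have he : (plpdm α b)^[p] (v : UnitAddCircle) - u
        = ((s * (v - u) : ℝ) : UnitAddCircle) := by
      rw [plpdm_iterate_coe, ← AddCircle.coe_sub, coe_eq_coe_iff_exists_int]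
      exact ⟨m, by rw [← hv, hm]; ring⟩
    rw [he, (AddCircle.norm_coe_eq_abs_iff (1 : ℝ) one_ne_zero).2 (by simpa using hv'.le),
      ← AddCircle.coe_sub]
    calc ‖((v - u : ℝ) : UnitAddCircle)‖ ≤ |v - u| := norm_coe_le_abs _
      _ ≤ s * |v - u| := le_mul_of_one_le_left (abs_nonneg _) hs
      _ = |s * (v - u)| := by rw [abs_mul, abs_of_pos (a := s) (by linarith)]
  have hcount : {v : ℝ | ∃ k : ℕ, (plpdm α b)^[p * k] (v : UnitAddCircle) = u}.Countable := by
    have hsub : {v : ℝ | ∃ k : ℕ, (plpdm α b)^[p * k] (v : UnitAddCircle) = u}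
        ⊆ ⋃ k : ℕ, ⋃ n : ℤ, {v | (realLift α b)^[p * k] v = u + n} := by
      rintro v ⟨k, hk⟩
      rw [plpdm_iterate_coe, coe_eq_coe_iff_exists_int] at hk
      simpa using ⟨k, hk⟩
    refine Countable.mono hsub (countable_iUnion fun k => countable_iUnion fun n => ?_)
    refine Set.Subsingleton.countable fun v hv w hw => ?_
    exact (realLift_strictMono α hb).injective.iterate (p * k) (hv.trans hw.symm)
  obtain ⟨v, hvU, hv⟩ := (hcount.dense_compl ℝ).inter_open_nonempty _
    (hUo.preimage continuous_coe_unitAddCircle) ⟨u, hxU⟩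
  have hlim := hU v hvU
  have hnorm : Tendsto (fun k => ‖(plpdm α b)^[p * k] (v : UnitAddCircle) - u‖) atTop (𝓝 0) :=
    tendsto_iff_norm_sub_tendsto_zero.1 hlim
  obtain ⟨K, hK⟩ := eventually_atTop.1 (hlim.eventually hexp)
  have hmono : ∀ k ≥ K, ‖(plpdm α b)^[p * K] (v : UnitAddCircle) - u‖
      ≤ ‖(plpdm α b)^[p * k] (v : UnitAddCircle) - u‖ := by
    intro k hk
    induction k, hk using Nat.le_induction with
    | base => exact le_rfl
    | succ k hk ih =>
      have h := hK k hk
      rw [← Function.iterate_add_apply, add_comm p, ← mul_add_one] at h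
      exact ih.trans h
  have hle := ge_of_tendsto hnorm (eventually_atTop.2 ⟨K, hmono⟩)
  refine hv ⟨K, ?_⟩
  rw [← sub_eq_zero, ← norm_le_zero_iff]
  exact hle

lemma tendsto_realLift_iterate_div {α b u : ℝ} {p : ℕ} (hp : 0 < p) {m : ℤ}
    (hm : (realLift α b)^[p] u = u + m) :
    Tendsto (fun n : ℕ => (realLift α b)^[n] u / 2 ^ n) atTop (𝓝 (m / (2 ^ p - 1))) := by
  have h2p : (2 : ℝ) ^ p - 1 ≠ 0 := by
    have := one_lt_pow₀ (one_lt_two (α := ℝ)) hp.ne'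
    linarith
  set c : ℝ := m / (2 ^ p - 1) with hc
  have hcm : (m : ℝ) = (2 ^ p - 1) * c := by rw [hc]; field_simp
  set e : ℕ → ℝ := fun n => (realLift α b)^[n] u - 2 ^ n * c with he
  have hper : Function.Periodic e p := by
    intro n
    simp only [he]
    rw [Function.iterate_add_apply, hm, realLift_iterate_add_intCast, hcm, pow_add]
    ring
  have hbd : ∀ n, |e n| ≤ ∑ i ∈ Finset.range p, |e i| := by
    intro n
    rw [← hper.map_mod_nat n]
    exact Finset.single_le_sum (f := fun i => |e i|) (fun i _ => abs_nonneg _)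
      (Finset.mem_range.2 (Nat.mod_lt n hp))
  have hz : Tendsto (fun n : ℕ => (1 / 2 : ℝ) ^ n * e n) atTop (𝓝 0) := by
    refine squeeze_zero_norm (a := fun n : ℕ => (1 / 2 : ℝ) ^ n * ∑ i ∈ Finset.range p, |e i|)
      (fun n => ?_) ?_
    · rw [Real.norm_eq_abs, abs_mul, abs_of_pos (by positivity)]
      exact mul_le_mul_of_nonneg_left (hbd n) (by positivity)
    · simpa using (tendsto_pow_atTop_nhds_zero_of_lt_one (r := (1 / 2 : ℝ)) (by norm_num)
        (by norm_num)).mul_const (∑ i ∈ Finset.range p, |e i|)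
  have hsum := hz.const_add c
  rw [add_zero] at hsum
  refine hsum.congr fun n => ?_
  simp only [he, one_div, inv_pow]
  field_simp
  ring

lemma phiMap_eq_of_iterate {α b : ℝ} {x : UnitAddCircle} {p : ℕ} (hp : 0 < p) {m : ℤ}
    (hm : (realLift α b)^[p] (rep x) = rep x + m) :
    phiMap α b x = ((m / (2 ^ p - 1) : ℝ) : UnitAddCircle) := by
  obtain ⟨c, hc⟩ := liftF_eq α b
  obtain ⟨d, hd⟩ := coe_eq_coe_iff_exists_int.1 (coe_rep (α : UnitAddCircle))
  have h2p : (2 : ℝ) ^ p - 1 ≠ 0 := by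
    have := one_lt_pow₀ (one_lt_two (α := ℝ)) hp.ne'
    linarith
  have hparam : rep (α : UnitAddCircle) + c = α + ((d + c : ℤ) : ℝ) := by
    rw [hd]; push_cast; ring
  have hm' : (realLift (rep (α : UnitAddCircle) + c) b)^[p] (rep x)
      = rep x + ((m + (2 ^ p - 1) * (d + c) : ℤ) : ℝ) := by
    rw [hparam, realLift_iterate_add_param, hm]
    push_cast
    ring
  rw [phiMap, Phi, hc, (tendsto_realLift_iterate_div hp hm').limUnder_eq,
    coe_eq_coe_iff_exists_int]
  refine ⟨d + c, ?_⟩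
  push_cast
  field_simp

lemma mem_Ioo_of_mem_Iminus {u : ℝ} (h : (u : UnitAddCircle) ∈ Iminus)
    (h0 : (u : UnitAddCircle) ≠ 0) (h1 : (u : UnitAddCircle) ≠ ((1 / 2 : ℝ) : UnitAddCircle)) :
    ∃ n : ℤ, u ∈ Ioo (n + 1 / 2 : ℝ) (n + 1) := by
  obtain ⟨t, ⟨ht0, ht1⟩, ht⟩ := h
  simp only at ht
  have hta : 1 / 2 ≠ t := by rintro rfl; exact h1 ht.symm
  have htb : t ≠ 1 := by
    rintro rfl
    exact h0 (by rw [← ht]; exact AddCircle.coe_period 1)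
  obtain ⟨n, rfl⟩ := coe_eq_coe_iff_exists_int.1 ht.symm
  have ha := lt_of_le_of_ne ht0 hta
  have hb := lt_of_le_of_ne ht1 htb
  exact ⟨n, by linarith, by linarith⟩

lemma mem_Ioo_of_mem_Iplus {u : ℝ} (h : (u : UnitAddCircle) ∈ Iplus)
    (h0 : (u : UnitAddCircle) ≠ 0) (h1 : (u : UnitAddCircle) ≠ ((1 / 2 : ℝ) : UnitAddCircle)) :
    ∃ n : ℤ, u ∈ Ioo (n : ℝ) (n + 1 / 2) := by
  obtain ⟨t, ⟨ht0, ht1⟩, ht⟩ := h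
  simp only at ht
  have hta : 0 ≠ t := by rintro rfl; exact h0 (by rw [← ht]; rfl)
  have htb : t ≠ 1 / 2 := by rintro rfl; exact h1 ht.symm
  obtain ⟨n, rfl⟩ := coe_eq_coe_iff_exists_int.1 ht.symm
  have ha := lt_of_le_of_ne ht0 hta
  have hb := lt_of_le_of_ne ht1 htb
  exact ⟨n, by linarith, by linarith⟩

lemma HasItinerary.hasSingleMinusItinerary {α b u : ℝ} {p : ℕ} {σ : Fin p → Bool} (hp : 0 < p)
    (hσ0 : σ ⟨0, hp⟩ = true) (hσ : ∃! j : Fin p, σ j = true)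
    (h : HasItinerary (plpdm α b) p u σ) : HasSingleMinusItinerary α b p u := by
  constructor
  · have h0 := h.1 ⟨0, hp⟩
    exact mem_Ioo_of_mem_Iminus ((h.2 ⟨0, hp⟩).1 hσ0) h0.1 h0.2
  · intro j hj0 hj
    have hj1 := h.1 ⟨j, hj⟩
    have hj2 := (h.2 ⟨j, hj⟩).2 (by
      rw [← Bool.not_eq_true]
      intro ht
      have := hσ.unique ht hσ0
      simp only [Fin.mk.injEq] at this
      omega)
    simp only [plpdm_iterate_coe] at hj1 hj2
    exact mem_Ioo_of_mem_Iplus hj2 hj1.1 hj1.2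

/-- An attracting orbit with single minus itinerary starting at `x` lifts to an orbit starting in
`(1/2, 1)` whose return slope is less than one. -/
lemma IsAttractingPeriodicPt.exists_lift {α b : ℝ} (hb : b ∈ Ico (0 : ℝ) 1) {p : ℕ}
    {σ : Fin p → Bool} (hp : 0 < p) (hσ0 : σ ⟨0, hp⟩ = true) (hσ : ∃! j : Fin p, σ j = true)
    {x : UnitAddCircle} (hatt : IsAttractingPeriodicPt (plpdm α b) p x)
    (hit : HasItinerary (plpdm α b) p x σ) :
    ∃ m : ℤ, rep x ∈ Ioo (1 / 2 : ℝ) 1 ∧ HasSingleMinusItinerary α b p (rep x) ∧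
      (realLift α b)^[p] (rep x) = rep x + m ∧
      (2 - 2 * b) * (2 + 2 * b) ^ (p - 1) < 1 := by
  have hx := coe_rep x
  have hI : rep x ∈ Ico (0 : ℝ) (0 + 1) := (AddCircle.equivIco 1 0 x).2
  generalize rep x = u at hx hI
  subst hx
  have hs := hit.hasSingleMinusItinerary hp hσ0 hσ
  have hfix := hatt.2.1
  rw [plpdm_iterate_coe, coe_eq_coe_iff_exists_int] at hfix
  obtain ⟨m, hm⟩ := hfix
  have haff := hs.eventually_iterate_sub (j := p - 1) (by omega)
  rw [Nat.sub_add_cancel hp] at haff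
  refine ⟨m, ?_, hs, hm, hatt.slope_lt_one hb hm haff⟩
  obtain ⟨n, hn0, hn1⟩ := hs.1
  have e1 : n < 1 := by
    have : (n : ℝ) < 1 := by linarith [hI.2]
    exact_mod_cast this
  have e2 : -1 < n := by
    have : (-1 : ℝ) < n := by linarith [hI.1]
    exact_mod_cast this
  obtain rfl : n = 0 := by omega
  simpa using And.intro hn0 hn1

lemma exists_eventually_iterate_eq {α b u : ℝ} {p : ℕ} (hp : 0 < p)
    (hu : u ∈ Ioo (1 / 2 : ℝ) 1) (hit : HasSingleMinusItinerary α b p u) {m : ℤ}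
    (hm : (realLift α b)^[p] u = u + m)
    (hs : (2 - 2 * b) * (2 + 2 * b) ^ (p - 1) < 1) :
    ∀ᶠ q : ℝ × ℝ in 𝓝 (α, b), ∃ v ∈ Ioo (1 / 2 : ℝ) 1,
      HasSingleMinusItinerary q.1 q.2 p v ∧ (realLift q.1 q.2)^[p] v = v + m := by
  have haff := hit.eventually_iterate_sub (j := p - 1) (by omega)
  rw [Nat.sub_add_cancel hp] at haff
  have hprod := hit.eventually_prod
  rw [nhds_prod_eq] at hprod
  obtain ⟨A, hA, B, hB, hAB⟩ := eventually_prod_iff.1 hprod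
  obtain ⟨ε, hε, hball⟩ := Metric.nhds_basis_closedBall.eventually_iff.1
    (haff.and (hB.and (isOpen_Ioo.mem_nhds hu)))
  rw [Real.closedBall_eq_Icc] at hball
  have hl := (hball (x := u - ε) ⟨le_rfl, by linarith⟩).1
  have hr := (hball (x := u + ε) ⟨by linarith, le_rfl⟩).1
  have hsε := mul_lt_mul_of_pos_right hs hε
  have hl' : ∀ᶠ q : ℝ × ℝ in 𝓝 (α, b), u - ε + m < (realLift q.1 q.2)^[p] (u - ε) :=
    (continuous_realLift_iterate_left (u - ε) p).continuousAt.eventually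
      (lt_mem_nhds (by simp only; linarith))
  have hr' : ∀ᶠ q : ℝ × ℝ in 𝓝 (α, b), (realLift q.1 q.2)^[p] (u + ε) < u + ε + m :=
    (continuous_realLift_iterate_left (u + ε) p).continuousAt.eventually
      (gt_mem_nhds (by simp only; linarith))
  filter_upwards [hA, hl', hr'] with q hqA hql hqr
  have hcont : ContinuousOn (fun v => (realLift q.1 q.2)^[p] v - v) (Icc (u - ε) (u + ε)) :=
    ((continuous_realLift_iterate_right q.1 q.2 p).sub continuous_id).continuousOn
  obtain ⟨v, hv, hvm⟩ := intermediate_value_Icc' (by linarith) hcont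
    (show (m : ℝ) ∈ Icc _ _ from ⟨by linarith, by linarith⟩)
  obtain ⟨-, hvB, hvI⟩ := hball hv
  exact ⟨v, hvI, hAB hqA hvB, by simp only at hvm; linarith⟩

lemma exists_eventually_phiMap_eq {p : ℕ} {σ : Fin p → Bool} (hp : 0 < p)
    (hσ0 : σ ⟨0, hp⟩ = true) (hσ : ∃! j : Fin p, σ j = true) {q₀ : UnitAddCircle × ℝ}
    (hq₀ : q₀ ∈ paramSet p σ) :
    ∃ m : ℤ, ∀ᶠ q in 𝓝 q₀, q.2 ∈ Ico (0 : ℝ) 1 → ∀ x : UnitAddCircle,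
      IsAttractingPeriodicPt (plpdm q.1 q.2) p x → HasItinerary (plpdm q.1 q.2) p x σ →
      phiMap q.1 q.2 x = ((m / (2 ^ p - 1) : ℝ) : UnitAddCircle) := by
  obtain ⟨a, b⟩ := q₀
  obtain ⟨hb, x₀, hatt, hit⟩ := hq₀
  obtain ⟨α, rfl⟩ : ∃ α : ℝ, (α : UnitAddCircle) = a := ⟨rep a, coe_rep a⟩
  obtain ⟨m, hu, hi, hm, hs⟩ := hatt.exists_lift hb hp hσ0 hσ hit
  refine ⟨m, ?_⟩
  have hmap : map (Prod.map (fun u : ℝ => (u : UnitAddCircle)) (id : ℝ → ℝ)) (𝓝 (α, b))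
      = 𝓝 ((α : UnitAddCircle), b) :=
    (isOpenMap_coe_unitAddCircle.prodMap IsOpenMap.id).map_nhds_eq
      (continuous_coe_unitAddCircle.prodMap continuous_id).continuousAt
  rw [← hmap, eventually_map]
  filter_upwards [exists_eventually_iterate_eq hp hu hi hm hs] with q hq hqb x hx hxi
  obtain ⟨v, hv, hvi, hvm⟩ := hq
  obtain ⟨m', hu', hi', hm', hs'⟩ := hx.exists_lift hqb hp hσ0 hσ hxi
  have hxv : rep x = v := eq_of_hasSingleMinusItinerary hqb hp hs' hu' hv hi' hvi hm' hvm
  exact phiMap_eq_of_iterate hp (by rw [hxv]; exact hvm)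

lemma exists_nat_coe_div_eq {p : ℕ} (hp : 0 < p) (m : ℤ) :
    ∃ k : ℕ, k ≤ 2 ^ p - 2 ∧ ((m / (2 ^ p - 1) : ℝ) : UnitAddCircle)
      = ((k / (2 ^ p - 1) : ℝ) : UnitAddCircle) := by
  have h2 : (1 : ℤ) < 2 ^ p := one_lt_pow₀ one_lt_two hp.ne'
  have h2p : (2 : ℝ) ^ p - 1 ≠ 0 := by
    have := one_lt_pow₀ (one_lt_two (α := ℝ)) hp.ne'
    linarith
  have h0 := Int.emod_nonneg m (b := 2 ^ p - 1) (by omega)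
  have h1 := Int.emod_lt_of_pos m (b := 2 ^ p - 1) (by omega)
  obtain ⟨k, hk⟩ := Int.eq_ofNat_of_zero_le h0
  refine ⟨k, ?_, ?_⟩
  · have : ((2 ^ p : ℕ) : ℤ) = 2 ^ p := by push_cast; rfl
    omega
  · rw [coe_eq_coe_iff_exists_int]
    refine ⟨m / (2 ^ p - 1), ?_⟩
    have hdm := Int.emod_add_mul_ediv m (2 ^ p - 1)
    rw [hk] at hdm
    have hdm' : (m : ℝ) = k + (2 ^ p - 1) * ((m / (2 ^ p - 1) : ℤ) : ℝ) := by
      exact_mod_cast hdm.symm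
    rw [div_add' _ _ _ h2p, div_left_inj' h2p]
    linarith

theorem stmt11 (p : ℕ) (hp : 0 < p) (σ : Fin p → Bool)
    (hσ0 : σ ⟨0, hp⟩ = true) (hσ : ∃! j : Fin p, σ j = true)
    (S : Set (UnitAddCircle × ℝ)) (q₀ : UnitAddCircle × ℝ) (hq₀ : q₀ ∈ paramSet p σ)
    (hS : S = connectedComponentIn (paramSet p σ) q₀) :
    ∃ k : ℕ, k ≤ 2^p - 2 ∧ ∀ q ∈ S, ∀ x : UnitAddCircle,
      IsAttractingPeriodicPt (plpdm q.1 q.2) p x →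
      HasItinerary (plpdm q.1 q.2) p x σ → x ∈ Iminus →
      phiMap q.1 q.2 x = (((k : ℝ) / (2^p - 1) : ℝ) : UnitAddCircle) := by
  subst hS
  have hsub := connectedComponentIn_subset (paramSet p σ) q₀
  have hex : ∀ q : UnitAddCircle × ℝ, ∃ v : UnitAddCircle, q ∈ paramSet p σ →
      ∃ x, IsAttractingPeriodicPt (plpdm q.1 q.2) p x ∧
        HasItinerary (plpdm q.1 q.2) p x σ ∧ phiMap q.1 q.2 x = v := by
    intro q
    by_cases hq : q ∈ paramSet p σ
    · obtain ⟨-, x, hx, hxi⟩ := id hq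
      exact ⟨phiMap q.1 q.2 x, fun _ => ⟨x, hx, hxi, rfl⟩⟩
    · exact ⟨0, fun h => absurd h hq⟩
  choose val hval using hex
  have hconst : ∀ q ∈ connectedComponentIn (paramSet p σ) q₀, val q₀ = val q := by
    intro q hq
    refine isPreconnected_connectedComponentIn.induction₂ (fun q q' => val q = val q') ?_
      (fun _ _ _ _ _ _ h h' => h.trans h') (fun _ _ _ _ h => h.symm)
      (mem_connectedComponentIn hq₀) hq
    intro q hq
    obtain ⟨m, hm⟩ := exists_eventually_phiMap_eq hp hσ0 hσ (hsub hq)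
    obtain ⟨x, hx, hxi, hxv⟩ := hval q (hsub hq)
    filter_upwards [nhdsWithin_le_nhds hm, self_mem_nhdsWithin] with q' hm' hq'
    obtain ⟨x', hx', hxi', hxv'⟩ := hval q' (hsub hq')
    rw [← hxv, ← hxv', hm' (hsub hq').1 x' hx' hxi',
      hm.self_of_nhds (hsub hq).1 x hx hxi]
  obtain ⟨m₀, hm₀⟩ := exists_eventually_phiMap_eq hp hσ0 hσ hq₀
  obtain ⟨k, hk, hkm⟩ := exists_nat_coe_div_eq hp m₀
  refine ⟨k, hk, fun q hq x hx hxi _ => ?_⟩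
  obtain ⟨x₀, hx₀, hxi₀, hxv₀⟩ := hval q₀ hq₀
  obtain ⟨m, hm⟩ := exists_eventually_phiMap_eq hp hσ0 hσ (hsub hq)
  obtain ⟨x', hx', hxi', hxv'⟩ := hval q (hsub hq)
  have hqx := hm.self_of_nhds (hsub hq).1
  rw [← hkm, ← hm₀.self_of_nhds hq₀.1 x₀ hx₀ hxi₀, hxv₀, hconst q hq, ← hxv',
    hqx x hx hxi, hqx x' hx' hxi']
end

section
/- Let σ be a single minus periodic slope itinerary. Then the set P_σ of parameters (a,b) ∈ ℝ/ℤ × [0,1) for which f_{a,b} has an attracting periodic orbit with slope itinerary σ is nonempty; moreover, every connected component of P_σ is a tongue, i.e. its closure intersects ℝ/ℤ × {1} in a nondegenerate interval. -/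
open Set Filter Topology

/-- The open minus arc, centred at `3/4`. -/
def OpenMinus (z : UnitAddCircle) : Prop := ∃ t : ℝ, |t| < 1/4 ∧ z = ((3/4 + t : ℝ) : UnitAddCircle)

/-- The open plus arc, centred at `1/4`. -/
def OpenPlus (z : UnitAddCircle) : Prop := ∃ t : ℝ, |t| < 1/4 ∧ z = ((1/4 + t : ℝ) : UnitAddCircle)

lemma rep_mem (z : UnitAddCircle) : 0 ≤ rep z ∧ rep z < 1 := by
  have h := (AddCircle.equivIco 1 0 z).2
  simpa [rep] using h

lemma coe_add_one (x : ℝ) : ((x + 1 : ℝ) : UnitAddCircle) = (x : UnitAddCircle) :=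
  AddCircle.coe_add_period 1 x

lemma coe_eq_coe_iff_int {x y : ℝ} :
    (x : UnitAddCircle) = (y : UnitAddCircle) ↔ ∃ n : ℤ, x = y + n := by
  rw [← sub_eq_zero, ← AddCircle.coe_sub, AddCircle.coe_eq_zero_iff]
  constructor
  · rintro ⟨n, hn⟩
    exact ⟨n, by simp at hn; linarith⟩
  · rintro ⟨n, hn⟩
    exact ⟨n, by simp; linarith⟩

lemma norm_coe_of_abs_le {x : ℝ} (h : |x| ≤ 1/2) : ‖(x : UnitAddCircle)‖ = |x| :=
  (AddCircle.norm_coe_eq_abs_iff 1 one_ne_zero).2 (by simpa using h)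

lemma norm_coe_le (x : ℝ) : ‖(x : UnitAddCircle)‖ ≤ |x| := by
  rw [UnitAddCircle.norm_eq]
  simpa using round_le x 0

lemma norm_coe_plus {t : ℝ} (h : |t| ≤ 1/4) : ‖((1/4 + t : ℝ) : UnitAddCircle)‖ = 1/4 + t := by
  rw [abs_le] at h
  rw [norm_coe_of_abs_le, abs_of_nonneg] <;> try rw [abs_le]
  · linarith
  · constructor <;> linarith

lemma norm_coe_minus {t : ℝ} (h : |t| ≤ 1/4) : ‖((3/4 + t : ℝ) : UnitAddCircle)‖ = 1/4 - t := by
  rw [abs_le] at h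
  have : ((3/4 + t : ℝ) : UnitAddCircle) = ((t - 1/4 : ℝ) : UnitAddCircle) := by
    rw [← coe_add_one (t - 1/4)]; congr 1; ring
  rw [this, norm_coe_of_abs_le, abs_of_nonpos] <;> try rw [abs_le]
  · linarith
  · linarith
  · constructor <;> linarith

lemma Sfun_rep (z : UnitAddCircle) : Sfun (rep z) = 4 * ‖z‖ - 1 := by
  obtain ⟨h0, h1⟩ := rep_mem z
  unfold Sfun
  split_ifs with h
  · have := norm_coe_plus (t := rep z - 1/4) (by rw [abs_le]; constructor <;> linarith)
    rw [show 1/4 + (rep z - 1/4) = rep z by ring, coe_rep] at this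
    rw [this]
  · have := norm_coe_minus (t := rep z - 3/4) (by rw [abs_le]; constructor <;> linarith)
    rw [show 3/4 + (rep z - 3/4) = rep z by ring, coe_rep] at this
    rw [this]; ring

lemma plpdm_eq (a : UnitAddCircle) (b : ℝ) (z : UnitAddCircle) :
    plpdm a b z = z + z + ((2 * b * ‖z‖ - b/2 : ℝ) : UnitAddCircle) + a := by
  have h : (2 * rep z + (b/2) * Sfun (rep z) : ℝ) = rep z + rep z + (2 * b * ‖z‖ - b/2) := by
    rw [Sfun_rep]; ring
  unfold plpdm
  rw [h, AddCircle.coe_add, AddCircle.coe_add, coe_rep]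

lemma plpdm_plus (a b : ℝ) {t : ℝ} (h : |t| ≤ 1/4) :
    plpdm (a : UnitAddCircle) b ((1/4 + t : ℝ) : UnitAddCircle)
      = ((1/2 + a + 2 * (1 + b) * t : ℝ) : UnitAddCircle) := by
  rw [plpdm_eq, norm_coe_plus h, ← AddCircle.coe_add, ← AddCircle.coe_add, ← AddCircle.coe_add]
  congr 1; ring

lemma plpdm_minus (a b : ℝ) {t : ℝ} (h : |t| ≤ 1/4) :
    plpdm (a : UnitAddCircle) b ((3/4 + t : ℝ) : UnitAddCircle)
      = ((1/2 + a + 2 * (1 - b) * t : ℝ) : UnitAddCircle) := by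
  rw [plpdm_eq, norm_coe_minus h, ← AddCircle.coe_add, ← AddCircle.coe_add, ← AddCircle.coe_add,
    ← coe_add_one (1/2 + a + _)]
  congr 1; ring

lemma norm_plpdm_sub_le (a : UnitAddCircle) {b : ℝ} (hb : 0 ≤ b) (z w : UnitAddCircle) :
    ‖plpdm a b z - plpdm a b w‖ ≤ 2 * (1 + b) * ‖z - w‖ := by
  have h : plpdm a b z - plpdm a b w
      = (z - w) + (z - w) + ((2 * b * (‖z‖ - ‖w‖) : ℝ) : UnitAddCircle) := by
    have hc : ((2 * b * (‖z‖ - ‖w‖) : ℝ) : UnitAddCircle) =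
        ((2 * b * ‖z‖ - b/2 : ℝ) : UnitAddCircle) - ((2 * b * ‖w‖ - b/2 : ℝ) : UnitAddCircle) := by
      rw [← AddCircle.coe_sub]; congr 1; ring
    rw [plpdm_eq, plpdm_eq, hc]
    abel
  have h1 : |2 * b * (‖z‖ - ‖w‖)| ≤ 2 * b * ‖z - w‖ := by
    rw [abs_mul, abs_of_nonneg (by positivity : 0 ≤ 2 * b)]
    exact mul_le_mul_of_nonneg_left (abs_norm_sub_norm_le z w) (by positivity)
  rw [h]
  refine (norm_add₃_le).trans ?_
  have := norm_coe_le (2 * b * (‖z‖ - ‖w‖))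
  linarith

lemma norm_iterate_plpdm_sub_le (a : UnitAddCircle) {b : ℝ} (hb : 0 ≤ b) (n : ℕ)
    (z w : UnitAddCircle) :
    ‖(plpdm a b)^[n] z - (plpdm a b)^[n] w‖ ≤ (2 * (1 + b)) ^ n * ‖z - w‖ := by
  induction n with
  | zero => simp
  | succ n ih =>
    rw [Function.iterate_succ_apply', Function.iterate_succ_apply']
    refine (norm_plpdm_sub_le a hb _ _).trans ?_
    rw [pow_succ', mul_assoc (2 * (1 + b))]
    exact mul_le_mul_of_nonneg_left ih (by positivity)

lemma openMinus_iff {z : UnitAddCircle} :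
    OpenMinus z ↔ z ∈ Iminus ∧ z ≠ 0 ∧ z ≠ (((1:ℝ)/2 : ℝ) : UnitAddCircle) := by
  constructor
  · rintro ⟨t, ht, rfl⟩
    have hn := norm_coe_minus ht.le
    rw [abs_lt] at ht
    refine ⟨⟨3/4 + t, ⟨by linarith, by linarith⟩, rfl⟩, ?_, ?_⟩ <;> intro h <;> rw [h] at hn
    · rw [norm_zero] at hn; linarith
    · rw [norm_coe_of_abs_le] at hn <;> norm_num [abs_of_pos] at hn ⊢
      linarith
  · rintro ⟨⟨x, ⟨h1, h2⟩, rfl⟩, h0, h3⟩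
    have h1' : (1/2 : ℝ) ≠ x := by rintro rfl; exact h3 rfl
    have h2' : x ≠ 1 := by
      rintro rfl; exact h0 (AddCircle.coe_period 1)
    have h1 := lt_of_le_of_ne h1 h1'
    have h2 := lt_of_le_of_ne h2 h2'
    exact ⟨x - 3/4, by rw [abs_lt]; constructor <;> linarith, by simp⟩

lemma openPlus_iff {z : UnitAddCircle} :
    OpenPlus z ↔ z ∈ Iplus ∧ z ≠ 0 ∧ z ≠ (((1:ℝ)/2 : ℝ) : UnitAddCircle) := by
  constructor
  · rintro ⟨t, ht, rfl⟩
    have hn := norm_coe_plus ht.le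
    rw [abs_lt] at ht
    refine ⟨⟨1/4 + t, ⟨by linarith, by linarith⟩, rfl⟩, ?_, ?_⟩ <;> intro h <;> rw [h] at hn
    · rw [norm_zero] at hn; linarith
    · rw [norm_coe_of_abs_le] at hn <;> norm_num [abs_of_pos] at hn ⊢
      linarith
  · rintro ⟨⟨x, ⟨h1, h2⟩, rfl⟩, h0, h3⟩
    have h1' : (0 : ℝ) ≠ x := by rintro rfl; exact h0 rfl
    have h2' : x ≠ 1/2 := by rintro rfl; exact h3 rfl
    have h1 := lt_of_le_of_ne h1 h1'
    have h2 := lt_of_le_of_ne h2 h2'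
    exact ⟨x - 1/4, by rw [abs_lt]; constructor <;> linarith, by simp⟩

lemma OpenPlus.not_openMinus {z : UnitAddCircle} (h : OpenPlus z) : ¬ OpenMinus z := by
  obtain ⟨s, hs, rfl⟩ := h
  rintro ⟨t, ht, h⟩
  obtain ⟨n, hn⟩ := coe_eq_coe_iff_int.1 h
  rw [abs_lt] at hs ht
  have h1 : (-1 : ℝ) < n := by linarith
  have h2 : (n : ℝ) < 0 := by linarith
  have h1 : -1 < n := by exact_mod_cast h1
  have h2 : n < 0 := by exact_mod_cast h2
  omega

lemma hasItinerary_iff {f : UnitAddCircle → UnitAddCircle} {p : ℕ} {x : UnitAddCircle}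
    {σ : Fin p → Bool} : HasItinerary f p x σ ↔
      ∀ j : Fin p, (σ j = true → OpenMinus (f^[(j : ℕ)] x)) ∧
        (σ j = false → OpenPlus (f^[(j : ℕ)] x)) := by
  simp only [openMinus_iff, openPlus_iff, HasItinerary]
  constructor
  · rintro ⟨h1, h2⟩ j
    exact ⟨fun h => ⟨(h2 j).1 h, h1 j⟩, fun h => ⟨(h2 j).2 h, h1 j⟩⟩
  · intro h
    refine ⟨fun j => ?_, fun j => ⟨fun hj => ((h j).1 hj).1, fun hj => ((h j).2 hj).1⟩⟩
    cases hj : σ j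
    · exact ((h j).2 hj).2
    · exact ((h j).1 hj).2

/-- The slope of the map on the arc labelled by `s`. -/
def arcSlope (b : ℝ) (s : Bool) : ℝ := if s then 2 * (1 - b) else 2 * (1 + b)

lemma plpdm_locally_affine (a : UnitAddCircle) (b : ℝ) {z : UnitAddCircle} {s : Bool}
    (h : (s = true → OpenMinus z) ∧ (s = false → OpenPlus z)) :
    ∃ δ > 0, ∀ u : ℝ, |u| < δ →
      plpdm a b (z + (u : UnitAddCircle)) = plpdm a b z + ((arcSlope b s * u : ℝ) : UnitAddCircle) := by
  rw [← coe_rep a]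
  cases s
  · obtain ⟨t, ht, rfl⟩ := h.2 rfl
    refine ⟨1/4 - |t|, by linarith, fun u hu => ?_⟩
    rw [← AddCircle.coe_add, add_assoc, plpdm_plus _ _ ht.le,
      plpdm_plus _ _ ((abs_add_le t u).trans (by linarith)), ← AddCircle.coe_add]
    congr 1; simp [arcSlope]; ring
  · obtain ⟨t, ht, rfl⟩ := h.1 rfl
    refine ⟨1/4 - |t|, by linarith, fun u hu => ?_⟩
    rw [← AddCircle.coe_add, add_assoc, plpdm_minus _ _ ht.le,
      plpdm_minus _ _ ((abs_add_le t u).trans (by linarith)), ← AddCircle.coe_add]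
    congr 1; simp [arcSlope]; ring

lemma iterate_plpdm_locally_affine (a : UnitAddCircle) (b : ℝ) {z : UnitAddCircle} (τ : ℕ → Bool)
    (n : ℕ) (h : ∀ i < n, (τ i = true → OpenMinus ((plpdm a b)^[i] z)) ∧
      (τ i = false → OpenPlus ((plpdm a b)^[i] z))) :
    ∃ δ > 0, ∀ u : ℝ, |u| < δ → (plpdm a b)^[n] (z + (u : UnitAddCircle)) =
      (plpdm a b)^[n] z + (((∏ i ∈ Finset.range n, arcSlope b (τ i)) * u : ℝ) : UnitAddCircle) := by
  induction n with
  | zero => exact ⟨1, one_pos, fun u _ => by simp⟩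
  | succ n ih =>
    obtain ⟨δ, hδ, H⟩ := ih fun i hi => h i (by omega)
    obtain ⟨ε, hε, H'⟩ := plpdm_locally_affine a b (h n (by omega))
    set L := ∏ i ∈ Finset.range n, arcSlope b (τ i)
    refine ⟨min δ (ε / (|L| + 1)), lt_min hδ (by positivity), fun u hu => ?_⟩
    rw [lt_min_iff, lt_div_iff₀ (by positivity)] at hu
    rw [Function.iterate_succ_apply', Function.iterate_succ_apply', H u hu.1, H',
      Finset.prod_range_succ]
    · congr 2; ring
    · rw [abs_mul]; nlinarith [abs_nonneg u]

lemma locally_affine_of_hasItinerary {a : UnitAddCircle} {b : ℝ} {P : ℕ} {x : UnitAddCircle}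
    {σ : Fin (P + 1) → Bool} (hσ : ∃! j, σ j = true)
    (hx : (plpdm a b)^[P + 1] x = x) (h : HasItinerary (plpdm a b) (P + 1) x σ) :
    ∃ δ > 0, ∀ u : ℝ, |u| < δ → (plpdm a b)^[P + 1] (x + (u : UnitAddCircle)) =
      x + ((2 * (1 - b) * (2 * (1 + b)) ^ P * u : ℝ) : UnitAddCircle) := by
  rw [hasItinerary_iff] at h
  obtain ⟨δ, hδ, H⟩ := iterate_plpdm_locally_affine a b (z := x)
    (fun i => if hi : i < P + 1 then σ ⟨i, hi⟩ else false) (P + 1)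
    (fun i hi => by simpa [hi] using h ⟨i, hi⟩)
  refine ⟨δ, hδ, fun u hu => ?_⟩
  rw [H u hu, hx]
  congr 3
  rw [Finset.prod_range]
  obtain ⟨j, hj, hu⟩ := hσ
  have : ∀ i : Fin (P + 1), i ∈ ({j}ᶜ : Finset (Fin (P + 1))) →
      arcSlope b (if hi : (i : ℕ) < P + 1 then σ ⟨i, hi⟩ else false) = 2 * (1 + b) := by
    intro i hi
    have : σ i ≠ true := fun h => by simp [hu i h] at hi
    simp [arcSlope, this]
  rw [Fintype.prod_eq_mul_prod_compl j, Finset.prod_congr rfl this]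
  simp [arcSlope, hj, Finset.card_compl, Nat.not_lt.2 (Nat.le_of_lt_succ j.2)]

lemma plpdm_preimage_countable (a : UnitAddCircle) {b : ℝ} (hb : b ∈ Ico (0:ℝ) 1)
    {s : Set UnitAddCircle} (hs : s.Countable) : (plpdm a b ⁻¹' s).Countable := by
  rw [← biUnion_of_singleton s, preimage_iUnion₂]
  refine hs.biUnion fun w _ => ?_
  have h : plpdm a b ⁻¹' {w} ⊆
      (range fun n : ℤ => ((1/4 + (rep w + n - 1/2 - rep a) / (2 * (1 + b)) : ℝ) : UnitAddCircle)) ∪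
      (range fun n : ℤ => ((3/4 + (rep w + n - 1/2 - rep a) / (2 * (1 - b)) : ℝ) : UnitAddCircle)) := by
    intro z hz
    rw [mem_preimage, mem_singleton_iff, ← coe_rep a, ← coe_rep w, ← coe_rep z] at hz
    have hp : 2 * (1 + b) ≠ 0 := by linarith [hb.1]
    have hm : 2 * (1 - b) ≠ 0 := by linarith [hb.2]
    obtain ⟨h0, h1⟩ := rep_mem z
    rcases le_total (rep z) (1/2) with h | h
    · left
      rw [show rep z = 1/4 + (rep z - 1/4) by ring,
        plpdm_plus _ _ (by rw [abs_le]; constructor <;> linarith), coe_eq_coe_iff_int] at hz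
      obtain ⟨n, hn⟩ := hz
      refine ⟨n, ?_⟩
      have hz : rep z = 1/4 + (rep w + n - 1/2 - rep a) / (2 * (1 + b)) := by
        rw [← sub_eq_iff_eq_add', eq_div_iff hp]
        linarith
      exact (congrArg _ hz.symm).trans (coe_rep z)
    · right
      rw [show rep z = 3/4 + (rep z - 3/4) by ring,
        plpdm_minus _ _ (by rw [abs_le]; constructor <;> linarith), coe_eq_coe_iff_int] at hz
      obtain ⟨n, hn⟩ := hz
      refine ⟨n, ?_⟩
      have hz : rep z = 3/4 + (rep w + n - 1/2 - rep a) / (2 * (1 - b)) := by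
        rw [← sub_eq_iff_eq_add', eq_div_iff hm]
        linarith
      exact (congrArg _ hz.symm).trans (coe_rep z)
  exact ((countable_range _).union (countable_range _)).mono h

lemma iterate_plpdm_preimage_countable (a : UnitAddCircle) {b : ℝ} (hb : b ∈ Ico (0:ℝ) 1)
    (w : UnitAddCircle) (n : ℕ) : ((plpdm a b)^[n] ⁻¹' {w}).Countable := by
  induction n with
  | zero => simp
  | succ n ih =>
    rw [Function.iterate_succ, preimage_comp]
    exact plpdm_preimage_countable a hb ih

lemma not_countable_of_isOpen {U : Set UnitAddCircle} (hU : IsOpen U) {x : UnitAddCircle}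
    (hx : x ∈ U) : ¬ U.Countable := by
  intro h
  have hc : Continuous fun u : ℝ => x + (u : UnitAddCircle) :=
    continuous_const.add (AddCircle.continuous_mk' 1)
  have hV := hU.preimage hc
  have h0 : (0 : ℝ) ∈ (fun u : ℝ => x + (u : UnitAddCircle)) ⁻¹' U := by simpa using hx
  obtain ⟨ε, hε, hball⟩ := Metric.isOpen_iff.1 hV 0 h0
  have hinj : InjOn (fun u : ℝ => x + (u : UnitAddCircle)) (Ioo 0 (min ε 1)) := by
    intro u hu v hv huv
    have := add_left_cancel huv
    obtain ⟨n, hn⟩ := coe_eq_coe_iff_int.1 this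
    have hu2 := lt_min_iff.1 hu.2
    have hv2 := lt_min_iff.1 hv.2
    have h1 : (-1 : ℝ) < n := by linarith [hu.1, hv.1]
    have h2 : (n : ℝ) < 1 := by linarith [hu.1, hv.1]
    have h1 : -1 < n := by exact_mod_cast h1
    have h2 : n < 1 := by exact_mod_cast h2
    have : n = 0 := by omega
    simpa [this] using hn
  have hsub : MapsTo (fun u : ℝ => x + (u : UnitAddCircle)) (Ioo 0 (min ε 1)) U := by
    intro u hu
    apply hball
    rw [Metric.mem_ball, Real.dist_eq, sub_zero, abs_of_pos hu.1]
    exact (lt_min_iff.1 hu.2).1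
  exact Cardinal.Real.Ioo_countable_iff.not.2 (by simp [hε]) (hsub.countable_of_injOn hinj h)

/-- A map that is locally affine at a fixed point with a slope at least one, and that has
countable iterated preimages of it, does not attract an open neighbourhood. -/
lemma slope_lt_one_of_attracting {g : UnitAddCircle → UnitAddCircle} {x : UnitAddCircle} {L : ℝ}
    (hc : ∀ k, (g^[k] ⁻¹' {x}).Countable)
    (hg : ∃ δ > 0, ∀ u : ℝ, |u| < δ → g (x + (u : UnitAddCircle)) =
      x + ((L * u : ℝ) : UnitAddCircle))
    {U : Set UnitAddCircle} (hU : IsOpen U) (hx : x ∈ U)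
    (hlim : ∀ y ∈ U, Tendsto (fun k => g^[k] y) atTop (𝓝 x)) : L < 1 := by
  by_contra! hL
  obtain ⟨δ, hδ, H⟩ := hg
  apply not_countable_of_isOpen hU hx
  refine (countable_iUnion hc).mono fun y hy => ?_
  set ε := min δ (1 / (2 * L))
  have hε : 0 < ε := lt_min hδ (by positivity)
  have hε2 : ε ≤ 1 / (2 * L) := min_le_right _ _
  have hlim' : Tendsto (fun k => ‖g^[k] y - x‖) atTop (𝓝 0) :=
    tendsto_iff_norm_sub_tendsto_zero.1 (hlim y hy)
  obtain ⟨N, hN⟩ := eventually_atTop.1 (hlim'.eventually (gt_mem_nhds hε))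
  have hstep : ∀ z, ‖z - x‖ < ε → ‖z - x‖ ≤ ‖g z - x‖ := by
    intro z hz
    obtain ⟨u, hu, hun⟩ : ∃ u : ℝ, (u : UnitAddCircle) = z - x ∧ |u| = ‖z - x‖ := by
      set r := rep (z - x)
      refine ⟨r - round r, ?_, ?_⟩
      · rw [← coe_rep (z - x), coe_eq_coe_iff_int]
        exact ⟨-round r, by push_cast; ring⟩
      · rw [← UnitAddCircle.norm_eq, coe_rep]
    rw [← hun] at hz
    have hz' := lt_of_lt_of_le hz hε2
    rw [lt_div_iff₀ (by positivity)] at hz'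
    have : z = x + (u : UnitAddCircle) := by rw [hu]; abel
    rw [← hun, this, H u (hz.trans_le (min_le_left _ _)), add_sub_cancel_left,
      norm_coe_of_abs_le, abs_mul, abs_of_nonneg (by linarith : 0 ≤ L)]
    · nlinarith [abs_nonneg u]
    · rw [abs_mul, abs_of_nonneg (by linarith : 0 ≤ L)]; nlinarith
  have hmono : ∀ k, ‖g^[N] y - x‖ ≤ ‖g^[N + k] y - x‖ := by
    intro k
    induction k with
    | zero => simp
    | succ k ih =>
      refine ih.trans ?_
      rw [← add_assoc, Function.iterate_succ_apply']
      exact hstep _ (hN (N + k) (by omega))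
  have h0 : ‖g^[N] y - x‖ ≤ 0 := by
    refine ge_of_tendsto hlim' (eventually_atTop.2 ⟨N, fun k hk => ?_⟩)
    obtain ⟨j, rfl⟩ := Nat.exists_eq_add_of_le hk
    exact hmono j
  exact mem_iUnion.2 ⟨N, sub_eq_zero.1 (norm_le_zero_iff.1 h0)⟩

lemma exists_attracting_nhd {g : UnitAddCircle → UnitAddCircle} {x : UnitAddCircle} {L : ℝ}
    (hL0 : 0 ≤ L) (hL : L < 1)
    (hg : ∃ δ > 0, ∀ u : ℝ, |u| < δ → g (x + (u : UnitAddCircle)) =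
      x + ((L * u : ℝ) : UnitAddCircle)) :
    ∃ U : Set UnitAddCircle, IsOpen U ∧ IsConnected U ∧ x ∈ U ∧ g '' U ⊆ U ∧
      ∀ y ∈ U, Tendsto (fun k => g^[k] y) atTop (𝓝 x) := by
  obtain ⟨δ, hδ, H⟩ := hg
  have hcoe : Continuous fun u : ℝ => (u : UnitAddCircle) := AddCircle.continuous_mk' 1
  have hc : Continuous fun u : ℝ => x + (u : UnitAddCircle) := continuous_const.add hcoe
  have ho : IsOpenMap fun u : ℝ => x + (u : UnitAddCircle) :=
    (isOpenMap_add_left x).comp QuotientAddGroup.isOpenMap_coe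
  have hlt : ∀ u : ℝ, |u| < δ → |L * u| < δ := by
    intro u hu
    rw [abs_mul, abs_of_nonneg hL0]
    nlinarith [abs_nonneg u]
  refine ⟨(fun u : ℝ => x + (u : UnitAddCircle)) '' Ioo (-δ) δ, ho _ isOpen_Ioo,
    (isConnected_Ioo (by linarith)).image _ hc.continuousOn,
    ⟨0, by simpa using hδ, by simp⟩, ?_, ?_⟩
  · rintro _ ⟨_, ⟨u, hu, rfl⟩, rfl⟩
    exact ⟨L * u, abs_lt.1 (hlt u (abs_lt.2 hu)), (H u (abs_lt.2 hu)).symm⟩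
  · rintro _ ⟨u, hu, rfl⟩
    have hk : ∀ k, |L ^ k * u| < δ ∧
        g^[k] (x + (u : UnitAddCircle)) = x + ((L ^ k * u : ℝ) : UnitAddCircle) := by
      intro k
      induction k with
      | zero => simpa using abs_lt.2 hu
      | succ k ih =>
        refine ⟨by rw [pow_succ', mul_assoc]; exact hlt _ ih.1, ?_⟩
        rw [Function.iterate_succ_apply', ih.2, H _ ih.1, pow_succ', mul_assoc]
    simp only [fun k => (hk k).2]
    have h1 : Tendsto (fun k : ℕ => L ^ k * u) atTop (𝓝 0) := by
      simpa using (tendsto_pow_atTop_nhds_zero_of_lt_one hL0 hL).mul_const u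
    simpa [Function.comp_def] using (hc.tendsto 0).comp h1

/-- A point `y` of period `P + 1` in the open minus arc whose other iterates lie in the open plus
arc, and whose multiplier is less than one. -/
def SingleMinusAttracting (P : ℕ) (q : UnitAddCircle × ℝ) (y : UnitAddCircle) : Prop :=
  2 * (1 - q.2) * (2 * (1 + q.2)) ^ P < 1 ∧ (plpdm q.1 q.2)^[P + 1] y = y ∧ OpenMinus y ∧
    ∀ i < P, OpenPlus ((plpdm q.1 q.2)^[i + 1] y)

lemma mem_paramSet_iff {P : ℕ} {σ : Fin (P + 1) → Bool} (hσ : ∃! j, σ j = true)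
    (q : UnitAddCircle × ℝ) :
    q ∈ paramSet (P + 1) σ ↔ q.2 ∈ Ico (0:ℝ) 1 ∧ ∃ y, SingleMinusAttracting P q y := by
  obtain ⟨a, b⟩ := q
  obtain ⟨j₀, hj₀, huniq⟩ := id hσ
  have hj₀' := j₀.2
  refine and_congr_right fun hb => ?_
  dsimp only at hb ⊢
  set f := plpdm a b with hf
  constructor
  · rintro ⟨x, ⟨-, hx, -, U, hU, -, hxU, -, hlim⟩, hit⟩
    have hper : Function.IsPeriodicPt f (P + 1) x := hx
    refine ⟨f^[j₀] x, ?_, hper.apply_iterate j₀, (hasItinerary_iff.1 hit j₀).1 hj₀, fun i hi => ?_⟩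
    · refine slope_lt_one_of_attracting (g := f^[P + 1]) (fun k => ?_)
        (locally_affine_of_hasItinerary hσ hx hit) hU hxU (fun y hy => ?_)
      · rw [← Function.iterate_mul]
        exact iterate_plpdm_preimage_countable a hb x _
      · simpa only [← Function.iterate_mul] using hlim y hy
    · dsimp only
      rw [← Function.iterate_add_apply, ← hper.iterate_mod_apply]
      have hlt : (i + 1 + j₀) % (P + 1) < P + 1 := Nat.mod_lt _ (by omega)
      refine (hasItinerary_iff.1 hit ⟨_, hlt⟩).2 ?_
      by_contra hne
      have := congrArg Fin.val (huniq ⟨_, hlt⟩ (by simpa using hne))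
      dsimp only at this
      rcases lt_or_ge (i + 1 + j₀) (P + 1) with h | h
      · rw [Nat.mod_eq_of_lt h] at this; omega
      · rw [Nat.mod_eq_sub_mod h, Nat.mod_eq_of_lt (by omega)] at this; omega
  · rintro ⟨y, hL, hy, hm, hplus⟩
    have hper : Function.IsPeriodicPt f (P + 1) y := hy
    set x := f^[P + 1 - j₀] y with hxdef
    have hx : f^[P + 1] x = x := hper.apply_iterate _
    have hxy : f^[j₀] x = y := by
      rw [hxdef, ← Function.iterate_add_apply, show (j₀ : ℕ) + (P + 1 - j₀) = P + 1 by omega, hy]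
    have hit : HasItinerary f (P + 1) x σ := by
      rw [hasItinerary_iff]
      intro j
      refine ⟨fun h => by rw [huniq j h, hxy]; exact hm, fun h => ?_⟩
      have hne : (j : ℕ) ≠ j₀ := by
        intro he
        rw [Fin.ext he, hj₀] at h
        exact absurd h (by simp)
      have hj := j.2
      rw [hxdef, ← Function.iterate_add_apply]
      rcases lt_or_ge (j : ℕ) j₀ with h | h
      · rw [show (j : ℕ) + (P + 1 - j₀) = (j + P - j₀) + 1 by omega]
        exact hplus _ (by omega)
      · rw [show (j : ℕ) + (P + 1 - j₀) = ((j - j₀ - 1) + 1) + (P + 1) by omega,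
          Function.iterate_add_apply, hy]
        exact hplus _ (by omega)
    refine ⟨x, ⟨by omega, hx, fun m hm0 hm1 hmx => ?_, ?_⟩, hit⟩
    · have : f^[m] y = y := by
        rw [← hxy, ← Function.iterate_add_apply, add_comm, Function.iterate_add_apply, hmx]
      have h := hplus (m - 1) (by omega)
      rw [show m - 1 + 1 = m by omega] at h
      dsimp only at h
      rw [← hf, this] at h
      exact h.not_openMinus hm
    · simp only [Function.iterate_mul]
      have hb1 : 0 ≤ 1 - b := by linarith [hb.2]
      have hb0 := hb.1
      exact exists_attracting_nhd (by positivity) hL (locally_affine_of_hasItinerary hσ hx hit)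

/-- Lifted orbit of `3/4 + t` under the map with `a = α - 1/4`, in coordinates centred at `1/4`,
where `m` records the integer translations and every point after the first is mapped by the plus
branch. -/
def liftedOrbit (m : ℕ → ℤ) (α b t : ℝ) : ℕ → ℝ
  | 0 => α + 2 * (1 - b) * t - m 0
  | n + 1 => α + 2 * (1 + b) * liftedOrbit m α b t n - m (n + 1)

/-- The derivative of `liftedOrbit` with respect to `α`. -/
def orbitDeriv (b : ℝ) : ℕ → ℝ
  | 0 => 1
  | n + 1 => 1 + 2 * (1 + b) * orbitDeriv b n

lemma liftedOrbit_eq_add (m : ℕ → ℤ) (α b t : ℝ) (n : ℕ) :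
    liftedOrbit m α b t n = liftedOrbit m 0 b t n + α * orbitDeriv b n := by
  induction n with
  | zero => simp [liftedOrbit, orbitDeriv]; ring
  | succ n ih => simp only [liftedOrbit, orbitDeriv, ih]; ring

lemma one_le_orbitDeriv {b : ℝ} (hb : 0 ≤ b) (n : ℕ) : 1 ≤ orbitDeriv b n := by
  induction n with
  | zero => simp [orbitDeriv]
  | succ n ih =>
    have : 0 ≤ 2 * (1 + b) * orbitDeriv b n := by positivity
    simp only [orbitDeriv]; linarith

lemma two_mul_orbitDeriv_lt {b : ℝ} (hb : 0 ≤ b) {n P : ℕ} (h : n < P) :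
    2 * orbitDeriv b n < orbitDeriv b P := by
  have hstep : ∀ k, 2 * orbitDeriv b k < orbitDeriv b (k + 1) := by
    intro k
    have := one_le_orbitDeriv hb k
    simp only [orbitDeriv]; nlinarith
  induction P, h using Nat.le_induction with
  | base => exact hstep n
  | succ k _ ih => linarith [hstep k, one_le_orbitDeriv hb k]

/-- The value of `α` for which the lifted orbit of `3/4 + t` closes up after `P + 1` steps. -/
noncomputable def closingParam (m : ℕ → ℤ) (P : ℕ) (b t : ℝ) : ℝ :=
  (t + 1/2 - liftedOrbit m 0 b t P) / orbitDeriv b P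

lemma liftedOrbit_eq_iff (m : ℕ → ℤ) (P : ℕ) {α b t : ℝ} (hb : 0 ≤ b) :
    liftedOrbit m α b t P = t + 1/2 ↔ α = closingParam m P b t := by
  have := one_le_orbitDeriv hb P
  rw [closingParam, eq_div_iff (by linarith), liftedOrbit_eq_add]
  constructor <;> intro h <;> linarith

lemma continuous_liftedOrbit {X : Type*} [TopologicalSpace X] (m : ℕ → ℤ) {α b t : X → ℝ}
    (hα : Continuous α) (hb : Continuous b) (ht : Continuous t) (n : ℕ) :
    Continuous fun x => liftedOrbit m (α x) (b x) (t x) n := by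
  induction n with
  | zero => simp only [liftedOrbit]; fun_prop
  | succ n ih => simp only [liftedOrbit]; fun_prop

lemma continuous_orbitDeriv {X : Type*} [TopologicalSpace X] {b : X → ℝ}
    (hb : Continuous b) (n : ℕ) : Continuous fun x => orbitDeriv (b x) n := by
  induction n with
  | zero => simp only [orbitDeriv]; fun_prop
  | succ n ih => simp only [orbitDeriv]; fun_prop

lemma continuous_closingParam {X : Type*} [TopologicalSpace X] (m : ℕ → ℤ) (P : ℕ) {b t : X → ℝ}
    (hb : Continuous b) (ht : Continuous t) (hb0 : ∀ x, 0 ≤ b x) :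
    Continuous fun x => closingParam m P (b x) (t x) := by
  unfold closingParam
  refine Continuous.div₀ ?_ (continuous_orbitDeriv hb P) fun x => ?_
  · have := continuous_liftedOrbit m (continuous_const (y := (0 : ℝ))) hb ht P
    fun_prop
  · linarith [one_le_orbitDeriv (hb0 x) P]

lemma liftedOrbit_at_one (m : ℕ → ℤ) (α t : ℝ) (n : ℕ) :
    liftedOrbit m α 1 t n = liftedOrbit m α 1 0 n := by
  induction n with
  | zero => simp [liftedOrbit]
  | succ n ih => simp only [liftedOrbit, ih]

lemma closingParam_at_one (m : ℕ → ℤ) (P : ℕ) (t : ℝ) :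
    closingParam m P 1 t = closingParam m P 1 0 + t / orbitDeriv 1 P := by
  rw [closingParam, closingParam, liftedOrbit_at_one]
  ring

lemma iterate_plpdm_eq_liftedOrbit (m : ℕ → ℤ) (P : ℕ) {α b t : ℝ} (ht : |t| ≤ 1/4)
    (h : ∀ n < P, |liftedOrbit m α b t n| ≤ 1/4) {n : ℕ} (hn : n ≤ P) :
    (plpdm ((α - 1/4 : ℝ) : UnitAddCircle) b)^[n + 1] ((3/4 + t : ℝ) : UnitAddCircle) =
      ((1/4 + liftedOrbit m α b t n : ℝ) : UnitAddCircle) := by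
  induction n with
  | zero =>
    rw [zero_add, Function.iterate_one, plpdm_minus _ _ ht, coe_eq_coe_iff_int]
    exact ⟨m 0, by simp only [liftedOrbit]; ring⟩
  | succ n ih =>
    rw [Function.iterate_succ_apply', ih (by omega), plpdm_plus _ _ (h n hn), coe_eq_coe_iff_int]
    exact ⟨m (n + 1), by simp only [liftedOrbit]; ring⟩

lemma iterate_plpdm_of_closing {m : ℕ → ℤ} {P : ℕ} {α b t : ℝ} (ht : |t| ≤ 1/4)
    (h : ∀ n < P, |liftedOrbit m α b t n| ≤ 1/4) (hP : liftedOrbit m α b t P = t + 1/2) :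
    (plpdm ((α - 1/4 : ℝ) : UnitAddCircle) b)^[P + 1] ((3/4 + t : ℝ) : UnitAddCircle) =
      ((3/4 + t : ℝ) : UnitAddCircle) := by
  rw [iterate_plpdm_eq_liftedOrbit m P ht h le_rfl, hP]
  congr 1; ring

lemma singleMinusAttracting_of_closing {m : ℕ → ℤ} {P : ℕ} {α b t : ℝ}
    (hL : 2 * (1 - b) * (2 * (1 + b)) ^ P < 1) (ht : |t| < 1/4)
    (h : ∀ n < P, |liftedOrbit m α b t n| < 1/4) (hP : liftedOrbit m α b t P = t + 1/2) :
    SingleMinusAttracting P (((α - 1/4 : ℝ) : UnitAddCircle), b)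
      ((3/4 + t : ℝ) : UnitAddCircle) := by
  have h' := fun n hn => (h n hn).le
  exact ⟨hL, iterate_plpdm_of_closing ht.le h' hP, ⟨t, ht, rfl⟩,
    fun i hi => ⟨_, h i hi, iterate_plpdm_eq_liftedOrbit m P ht.le h' hi.le⟩⟩

/-- When the multiplier is less than one, two points of the closed minus arc that are both fixed by
the `P + 1`-st iterate coincide; hence the other points of the orbit stay off the break points. -/
lemma abs_liftedOrbit_lt {m : ℕ → ℤ} {P : ℕ} {α b t : ℝ} (hb : b ∈ Ico (0:ℝ) 1)
    (hL : 2 * (1 - b) * (2 * (1 + b)) ^ P < 1) (ht : |t| < 1/4)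
    (h : ∀ n < P, |liftedOrbit m α b t n| ≤ 1/4) (hP : liftedOrbit m α b t P = t + 1/2)
    {n : ℕ} (hn : n < P) : |liftedOrbit m α b t n| < 1/4 := by
  refine lt_of_le_of_ne (h n hn) fun heq => ?_
  have hit := iterate_plpdm_eq_liftedOrbit m P ht.le h hn.le
  have hper : Function.IsPeriodicPt (plpdm ((α - 1/4 : ℝ) : UnitAddCircle) b) (P + 1)
    ((3/4 + t : ℝ) : UnitAddCircle) := iterate_plpdm_of_closing ht.le h hP
  obtain ⟨s, hs, hsw⟩ : ∃ s : ℝ, |s| = 1/4 ∧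
      ((1/4 + liftedOrbit m α b t n : ℝ) : UnitAddCircle) = ((3/4 + s : ℝ) : UnitAddCircle) := by
    rcases (abs_eq (by norm_num)).1 heq with h | h <;> rw [h]
    · exact ⟨-(1/4), by norm_num [abs_of_pos], by norm_num⟩
    · refine ⟨1/4, by norm_num [abs_of_pos], ?_⟩
      rw [← coe_add_one]; norm_num
  have hw := hper.apply_iterate (n + 1)
  rw [hit, hsw] at hw
  set f := plpdm ((α - 1/4 : ℝ) : UnitAddCircle) b with hf
  have hts : |t - s| ≤ 1/2 := (abs_sub t s).trans (by linarith)
  have hnorm : ‖((3/4 + t : ℝ) : UnitAddCircle) - ((3/4 + s : ℝ) : UnitAddCircle)‖ = |t - s| := by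
    rw [← AddCircle.coe_sub, show 3/4 + t - (3/4 + s) = t - s by ring, norm_coe_of_abs_le hts]
  have hb0 := hb.1
  have hb1 : 0 ≤ 1 - b := by linarith [hb.2]
  have hcontr := norm_iterate_plpdm_sub_le ((α - 1/4 : ℝ) : UnitAddCircle) hb.1 P
    (f ((3/4 + t : ℝ) : UnitAddCircle)) (f ((3/4 + s : ℝ) : UnitAddCircle))
  rw [← hf, ← Function.iterate_succ_apply, ← Function.iterate_succ_apply] at hcontr
  have h1 : f^[P.succ] ((3/4 + t : ℝ) : UnitAddCircle) = ((3/4 + t : ℝ) : UnitAddCircle) := hper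
  have h2 : f^[P.succ] ((3/4 + s : ℝ) : UnitAddCircle) = ((3/4 + s : ℝ) : UnitAddCircle) := hw
  rw [h1, h2, hnorm, hf, plpdm_minus _ _ ht.le, plpdm_minus _ _ hs.le, ← AddCircle.coe_sub,
    show 1/2 + (α - 1/4) + 2 * (1 - b) * t - (1/2 + (α - 1/4) + 2 * (1 - b) * s) =
      2 * (1 - b) * (t - s) by ring] at hcontr
  have h3 := norm_coe_le (2 * (1 - b) * (t - s))
  rw [abs_mul, abs_of_nonneg (by positivity : 0 ≤ 2 * (1 - b))] at h3
  have h4 : |t - s| ≤ (2 * (1 - b) * (2 * (1 + b)) ^ P) * |t - s| := by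
    refine hcontr.trans ?_
    rw [show 2 * (1 - b) * (2 * (1 + b)) ^ P * |t - s| =
      (2 * (1 + b)) ^ P * (2 * (1 - b) * |t - s|) by ring]
    exact mul_le_mul_of_nonneg_left h3 (by positivity)
  have h5 : |t - s| = 0 := by nlinarith [abs_nonneg (t - s)]
  rw [abs_eq_zero, sub_eq_zero] at h5
  rw [h5] at ht
  linarith

lemma exists_closing {P : ℕ} {q : UnitAddCircle × ℝ} {y : UnitAddCircle}
    (hb : 0 ≤ q.2) (h : SingleMinusAttracting P q y) :
    ∃ (m : ℕ → ℤ) (t : ℝ), |t| < 1/4 ∧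
      q.1 = ((closingParam m P q.2 t - 1/4 : ℝ) : UnitAddCircle) ∧
      ∀ n < P, |liftedOrbit m (closingParam m P q.2 t) q.2 t n| < 1/4 := by
  obtain ⟨a, b⟩ := q
  obtain ⟨-, hy, ⟨t, ht, rfl⟩, hplus⟩ := h
  dsimp only at *
  set f := plpdm a b with hf
  set y : UnitAddCircle := ((3/4 + t : ℝ) : UnitAddCircle) with hydef
  set α := rep a + 1/4 with hα
  have ha : ((α - 1/4 : ℝ) : UnitAddCircle) = a := by
    rw [hα, add_sub_cancel_right, coe_rep]
  obtain ⟨v, hv, hvP⟩ : ∃ v : ℕ → ℝ, (∀ n < P, |v n| < 1/4 ∧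
      f^[n + 1] y = ((1/4 + v n : ℝ) : UnitAddCircle)) ∧ v P = t + 1/2 := by
    choose! v hv using hplus
    refine ⟨fun n => if n < P then v n else t + 1/2, fun n hn => ?_, by simp⟩
    simpa only [hn, if_true] using hv n hn
  have hv' : ∀ n ≤ P, f^[n + 1] y = ((1/4 + v n : ℝ) : UnitAddCircle) := by
    intro n hn
    rcases hn.lt_or_eq with h | rfl
    · exact (hv n h).2
    · rw [hvP, hy, hydef]; congr 1; ring
  obtain ⟨m₀, hm₀⟩ : ∃ m : ℤ, α + 2 * (1 - b) * t - m = v 0 := by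
    have := hv' 0 (Nat.zero_le _)
    rw [zero_add, Function.iterate_one, hydef, hf, ← ha, plpdm_minus _ _ ht.le,
      coe_eq_coe_iff_int] at this
    obtain ⟨m, hm⟩ := this
    exact ⟨m, by linarith⟩
  have hstep : ∀ n, ∃ m : ℤ, n < P → α + 2 * (1 + b) * v n - m = v (n + 1) := by
    intro n
    by_cases hn : n < P
    · have := hv' (n + 1) hn
      rw [Function.iterate_succ_apply', (hv n hn).2, hf, ← ha, plpdm_plus _ _ (hv n hn).1.le,
        coe_eq_coe_iff_int] at this
      obtain ⟨m, hm⟩ := this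
      exact ⟨m, fun _ => by linarith⟩
    · exact ⟨0, fun h => absurd h hn⟩
  choose m hm using hstep
  let m' : ℕ → ℤ := fun n => Nat.casesOn n m₀ m
  have hlift : ∀ n ≤ P, liftedOrbit m' α b t n = v n := by
    intro n
    induction n with
    | zero => intro _; exact hm₀
    | succ n ih =>
      intro hn
      rw [← hm n hn, ← ih (by omega)]
      rfl
  have hclose := (liftedOrbit_eq_iff m' P hb).1 ((hlift P le_rfl).trans hvP)
  refine ⟨m', t, ht, by rw [← hclose, ha], fun n hn => ?_⟩
  rw [← hclose, hlift n hn.le]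
  exact (hv n hn).1

lemma multiplier_lt_one_of_le {P : ℕ} {b₀ b : ℝ} (h0 : 0 ≤ b₀) (hb : b₀ ≤ b) (hb1 : b < 1)
    (hL : 2 * (1 - b₀) * (2 * (1 + b₀)) ^ P < 1) : 2 * (1 - b) * (2 * (1 + b)) ^ P < 1 := by
  have h2 : (1:ℝ) ≤ 2 ^ P := one_le_pow₀ (by norm_num)
  have hP : (P:ℝ) * (1 - b₀) ≤ 1 + b₀ := by
    by_contra! hlt
    have hB := one_add_mul_le_pow (by linarith : (-2:ℝ) ≤ b₀) P
    rw [mul_pow] at hL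
    have h3 : 1 ≤ (1 - b₀) * (1 + b₀) ^ P := by
      refine le_trans ?_ (mul_le_mul_of_nonneg_left hB (by linarith))
      nlinarith
    nlinarith [mul_le_mul h2 h3 zero_le_one (by positivity)]
  refine lt_of_le_of_lt ?_ hL
  have hu : 0 < 1 - b₀ := by linarith
  have hw : 0 < 1 + b₀ := by linarith
  have e1 : 1 - b ≤ (1 - b₀) * Real.exp (-((b - b₀) / (1 - b₀))) := by
    have := Real.add_one_le_exp (-((b - b₀) / (1 - b₀)))
    calc 1 - b = (1 - b₀) * (-((b - b₀) / (1 - b₀)) + 1) := by field_simp; ring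
      _ ≤ _ := mul_le_mul_of_nonneg_left this hu.le
  have e2 : 1 + b ≤ (1 + b₀) * Real.exp ((b - b₀) / (1 + b₀)) := by
    have := Real.add_one_le_exp ((b - b₀) / (1 + b₀))
    calc 1 + b = (1 + b₀) * ((b - b₀) / (1 + b₀) + 1) := by field_simp; ring
      _ ≤ _ := mul_le_mul_of_nonneg_left this hw.le
  have e3 : Real.exp (-((b - b₀) / (1 - b₀))) * Real.exp ((b - b₀) / (1 + b₀)) ^ P ≤ 1 := by
    rw [← Real.exp_nat_mul, ← Real.exp_add, Real.exp_le_one_iff]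
    have : (P:ℝ) / (1 + b₀) ≤ 1 / (1 - b₀) := by
      rw [div_le_div_iff₀ hw hu]; linarith
    have := mul_le_mul_of_nonneg_left this (by linarith : 0 ≤ b - b₀)
    calc _ = (b - b₀) * (P / (1 + b₀)) - (b - b₀) * (1 / (1 - b₀)) := by ring
      _ ≤ 0 := by linarith
  have h1b : 0 ≤ 1 + b := by linarith
  calc 2 * (1 - b) * (2 * (1 + b)) ^ P
      ≤ 2 * ((1 - b₀) * Real.exp (-((b - b₀) / (1 - b₀)))) *
        (2 * ((1 + b₀) * Real.exp ((b - b₀) / (1 + b₀)))) ^ P := by gcongr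
    _ = 2 * (1 - b₀) * (2 * (1 + b₀)) ^ P *
        (Real.exp (-((b - b₀) / (1 - b₀))) * Real.exp ((b - b₀) / (1 + b₀)) ^ P) := by
      simp only [mul_pow]; ring
    _ ≤ 2 * (1 - b₀) * (2 * (1 + b₀)) ^ P := mul_le_of_le_one_right (by positivity) e3

lemma exists_multiplier_lt_one (P : ℕ) :
    ∃ b : ℝ, b ∈ Ico (0:ℝ) 1 ∧ 2 * (1 - b) * (2 * (1 + b)) ^ P < 1 := by
  have hc : Continuous fun b : ℝ => 2 * (1 - b) * (2 * (1 + b)) ^ P := by fun_prop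
  have h1 : ∀ᶠ b in 𝓝 (1:ℝ), 2 * (1 - b) * (2 * (1 + b)) ^ P < 1 :=
    (hc.tendsto 1).eventually (gt_mem_nhds (by norm_num))
  have h2 : ∀ᶠ b in 𝓝[<] (1:ℝ), b ∈ Ico (0:ℝ) 1 := Ico_mem_nhdsLT (by norm_num)
  obtain ⟨b, hb⟩ := (h2.and (h1.filter_mono nhdsWithin_le_nhds)).exists
  exact ⟨b, hb⟩

lemma paramSet_nonempty {P : ℕ} {σ : Fin (P + 1) → Bool} (hσ : ∃! j, σ j = true) :
    (paramSet (P + 1) σ).Nonempty := by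
  obtain ⟨b, hb, hL⟩ := exists_multiplier_lt_one P
  have h0 : ∀ n, liftedOrbit 0 0 b 0 n = 0 := by
    intro n
    induction n with
    | zero => simp [liftedOrbit]
    | succ n ih => simp [liftedOrbit, ih]
  refine ⟨_, (mem_paramSet_iff hσ _).2 ⟨hb, _, singleMinusAttracting_of_closing (m := 0)
    (α := closingParam 0 P b 0) (t := 0) hL (by norm_num) (fun n hn => ?_)
    ((liftedOrbit_eq_iff 0 P hb.1).2 rfl)⟩⟩
  have h1 := one_le_orbitDeriv hb.1 P
  have h2 := one_le_orbitDeriv hb.1 n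
  have h3 := two_mul_orbitDeriv_lt hb.1 hn
  rw [liftedOrbit_eq_add, h0, closingParam, h0, zero_add, zero_add, sub_zero,
    div_mul_eq_mul_div, abs_of_nonneg (by positivity), div_lt_iff₀ (by linarith)]
  linarith

/-- Along the whole strip `|t| < 1/4`, `b₀ ≤ b < 1` the closed-up orbit keeps its itinerary. -/
lemma abs_liftedOrbit_lt_on_strip {m : ℕ → ℤ} {P : ℕ} {b₀ t₀ : ℝ} (hb₀ : b₀ ∈ Ico (0:ℝ) 1)
    (hL : 2 * (1 - b₀) * (2 * (1 + b₀)) ^ P < 1) (ht₀ : |t₀| < 1/4)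
    (h : ∀ n < P, |liftedOrbit m (closingParam m P b₀ t₀) b₀ t₀ n| < 1/4)
    {b t : ℝ} (hb : b ∈ Ico b₀ 1) (ht : |t| < 1/4) :
    ∀ n < P, |liftedOrbit m (closingParam m P b t) b t n| < 1/4 := by
  let V : ℕ → ℝ × ℝ → ℝ := fun n x => liftedOrbit m (closingParam m P |x.2| x.1) |x.2| x.1 n
  have hV : ∀ n, Continuous (V n) := fun n => continuous_liftedOrbit m
    (continuous_closingParam m P (by fun_prop) (by fun_prop) fun _ => abs_nonneg _)
    (by fun_prop) (by fun_prop) n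
  set R : Set (ℝ × ℝ) := Ioo (-(1/4)) (1/4) ×ˢ Ico b₀ 1
  have hR : IsPreconnected R := isPreconnected_Ioo.prod isPreconnected_Ico
  have habs : ∀ x ∈ R, |x.2| = x.2 := fun x hx => abs_of_nonneg (hb₀.1.trans hx.2.1)
  let A : Set (ℝ × ℝ) := {x | ∀ n < P, |V n x| < 1/4}
  let B : Set (ℝ × ℝ) := {x | ∃ n < P, 1/4 < |V n x|}
  have hA : IsOpen A := by
    have : A = ⋂ n ∈ Finset.range P, {x | |V n x| < 1/4} := by ext; simp [A]
    rw [this]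
    exact isOpen_biInter_finset fun n _ => isOpen_lt (hV n).abs continuous_const
  have hB : IsOpen B := by
    have : B = ⋃ n, ⋃ _ : n < P, {x | 1/4 < |V n x|} := by ext; simp [B]
    rw [this]
    exact isOpen_iUnion fun n => isOpen_iUnion fun _ => isOpen_lt continuous_const (hV n).abs
  have hAB : Disjoint A B := by
    rw [Set.disjoint_left]
    rintro x hx ⟨n, hn, hlt⟩
    exact lt_asymm (hx n hn) hlt
  have hcover : R ⊆ A ∪ B := by
    intro x hx
    by_cases hxB : x ∈ B
    · exact Or.inr hxB
    · refine Or.inl fun n hn => ?_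
      have hle : ∀ n < P, |V n x| ≤ 1/4 := fun n hn => not_lt.1 fun hlt => hxB ⟨n, hn, hlt⟩
      have hx0 : 0 ≤ x.2 := hb₀.1.trans hx.2.1
      simp only [V, habs x hx] at hle ⊢
      exact abs_liftedOrbit_lt ⟨hx0, hx.2.2⟩
        (multiplier_lt_one_of_le hb₀.1 hx.2.1 hx.2.2 hL) (abs_lt.2 hx.1) hle
        ((liftedOrbit_eq_iff m P hx0).2 rfl) hn
  have hne : (R ∩ A).Nonempty := by
    have hmem : (t₀, b₀) ∈ R := ⟨abs_lt.1 ht₀, le_rfl, hb₀.2⟩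
    refine ⟨(t₀, b₀), hmem, fun n hn => ?_⟩
    simpa only [V, habs _ hmem] using h n hn
  have hmem : (t, b) ∈ R := ⟨abs_lt.1 ht, hb⟩
  intro n hn
  simpa only [V, habs _ hmem] using hR.subset_left_of_subset_union hA hB hAB hcover hne hmem n hn

lemma isTongue_connectedComponentIn {P : ℕ} {σ : Fin (P + 1) → Bool} (hσ : ∃! j, σ j = true)
    {q : UnitAddCircle × ℝ} (hq : q ∈ paramSet (P + 1) σ) :
    IsTongue (connectedComponentIn (paramSet (P + 1) σ) q) := by
  obtain ⟨hb₀, y, hy⟩ := (mem_paramSet_iff hσ q).1 hq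
  obtain ⟨m, t₀, ht₀, hq1, h⟩ := exists_closing hb₀.1 hy
  let Ψ : ℝ × ℝ → UnitAddCircle × ℝ :=
    fun x => (((closingParam m P |x.2| x.1 - 1/4 : ℝ) : UnitAddCircle), x.2)
  have hΨ : Continuous Ψ := by
    have h1 : Continuous fun x : ℝ × ℝ => closingParam m P |x.2| x.1 :=
      continuous_closingParam m P (by fun_prop) (by fun_prop) fun _ => abs_nonneg _
    exact ((AddCircle.continuous_mk' 1).comp (h1.sub continuous_const)).prodMk continuous_snd
  set R : Set (ℝ × ℝ) := Ioo (-(1/4)) (1/4) ×ˢ Ico q.2 1 with hRdef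
  have hR : IsPreconnected R := isPreconnected_Ioo.prod isPreconnected_Ico
  have hsub : Ψ '' R ⊆ paramSet (P + 1) σ := by
    rintro _ ⟨⟨t, b⟩, ⟨ht, hb⟩, rfl⟩
    have hb0 : 0 ≤ b := hb₀.1.trans hb.1
    have ht : |t| < 1/4 := abs_lt.2 ht
    refine (mem_paramSet_iff hσ _).2 ⟨⟨hb0, hb.2⟩, ((3/4 + t : ℝ) : UnitAddCircle), ?_⟩
    simp only [Ψ, abs_of_nonneg hb0]
    exact singleMinusAttracting_of_closing (multiplier_lt_one_of_le hb₀.1 hb.1 hb.2 hy.1) ht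
      (abs_liftedOrbit_lt_on_strip hb₀ hy.1 ht₀ h hb ht) ((liftedOrbit_eq_iff m P hb0).2 rfl)
  have hqmem : q ∈ Ψ '' R := by
    refine ⟨(t₀, q.2), ⟨abs_lt.1 ht₀, le_rfl, hb₀.2⟩, ?_⟩
    simp only [Ψ, abs_of_nonneg hb₀.1]
    exact Prod.ext hq1.symm rfl
  have hcomp := (hR.image Ψ hΨ.continuousOn).subset_connectedComponentIn hqmem hsub
  have hK := one_le_orbitDeriv zero_le_one P
  have hK0 : 0 < orbitDeriv 1 P := by linarith
  refine ⟨closingParam m P 1 0 - 1/4 - 1/8 / orbitDeriv 1 P,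
    closingParam m P 1 0 - 1/4 + 1/8 / orbitDeriv 1 P, ?_, fun s hs => ?_⟩
  · have : 0 < 1/8 / orbitDeriv 1 P := by positivity
    linarith
  · refine closure_mono hcomp (image_closure_subset_closure_image hΨ
      ⟨((s - (closingParam m P 1 0 - 1/4)) * orbitDeriv 1 P, 1), ?_, ?_⟩)
    · rw [hRdef, closure_prod_eq, closure_Ico hb₀.2.ne]
      refine ⟨subset_closure ?_, hb₀.2.le, le_rfl⟩
      have h1 : -(1/8 / orbitDeriv 1 P) ≤ s - (closingParam m P 1 0 - 1/4) := by linarith [hs.1]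
      have h2 : s - (closingParam m P 1 0 - 1/4) ≤ 1/8 / orbitDeriv 1 P := by linarith [hs.2]
      rw [← neg_div, div_le_iff₀ hK0] at h1
      rw [le_div_iff₀ hK0] at h2
      constructor <;> dsimp only <;> linarith
    · simp only [Ψ, abs_one]
      rw [closingParam_at_one, mul_div_cancel_right₀ _ hK0.ne']
      congr 2; ring

theorem stmt14 (p : ℕ) (hp : 0 < p) (σ : Fin p → Bool)
    (hσ : ∃! j : Fin p, σ j = true) :
    (paramSet p σ).Nonempty ∧
    ∀ q ∈ paramSet p σ, IsTongue (connectedComponentIn (paramSet p σ) q) := by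
  obtain ⟨P, rfl⟩ : ∃ P, p = P + 1 := ⟨p - 1, by omega⟩
  exact ⟨paramSet_nonempty hσ, fun q hq => isTongue_connectedComponentIn hσ hq⟩
end
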